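/- Let (X,d,m) be a locally uniformly doubling, strongly rectifiable metric measure space satisfying a Poincaré inequality, Ω ⊂ X an open set, and Y_o = (Y,d_Y,o) a pointed complete metric space. Let u,v,w ∈ KS^{1,2}(Ω,Y_o) and α > 0. For x ∈ Ω set Ω_{v,w,α,x} := {y ∈ Ω : d_Y(v(x),v(y)) ≥ α or d_Y(w(x),w(y)) ≥ α}, and define the modified approximate energy ks_{2,r}[u,Ω;v,w,α](x) := ((1/m(B_r(x))) ∫_{B_r(x)∖Ω_{v,w,α,x}} d_Y(u(x),u(y))²/r² dm(y))^{1/2} if B_r(x) ⊂ Ω and 0 otherwise. Then ks_{2,r}[u,Ω;v,w,α] → e_2[u] m-a.e. on Ω and in L²(Ω) as r ↓ 0. -/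

import Mathlib

open MeasureTheory Metric Filter Topology Set
open scoped ENNReal NNReal

noncomputable section

namespace KSH

attribute [local instance] Classical.propDecidable

variable {X Y : Type*}

/-! ### Metric measure space basics -/

/-- The measure is finite on bounded sets. -/
def FiniteOnBounded [PseudoMetricSpace X] [MeasurableSpace X] (m : Measure X) : Prop :=
  ∀ s : Set X, Bornology.IsBounded s → m s < ⊤

/-- Locally uniformly doubling measure. -/
def LocUnifDoubling [PseudoMetricSpace X] [MeasurableSpace X] (m : Measure X) : Prop :=
  ∀ R : ℝ, 0 < R → ∃ C : ℝ≥0, 0 < C ∧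
    ∀ (x : X) (r : ℝ), 0 < r → r < R →
      m (Metric.ball x (2 * r)) ≤ (C : ℝ≥0∞) * m (Metric.ball x r)

/-- Pointwise Lipschitz constant (`ℝ≥0∞`-valued); it equals `0` at isolated points. -/
def elip [PseudoEMetricSpace X] [PseudoEMetricSpace Y] (f : X → Y) (x : X) : ℝ≥0∞ :=
  Filter.limsup (fun y => edist (f x) (f y) / edist x y) (𝓝[≠] x)

/-- A (local, uniform) Poincaré inequality. -/
def PoincareIneq [PseudoMetricSpace X] [MeasurableSpace X] (m : Measure X) : Prop :=
  ∀ R : ℝ, 0 < R → ∃ C : ℝ, 0 < C ∧ ∃ lam : ℝ, 0 < lam ∧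
    ∀ f : X → ℝ, (∃ K : ℝ≥0, LipschitzWith K f) →
      ∀ (x : X) (r : ℝ), 0 < r → r < R →
        (⨍ y in Metric.ball x r, |f y - ⨍ z in Metric.ball x r, f z ∂m| ∂m) ≤
          C * r * ⨍ y in Metric.ball x (lam * r), (elip f y).toReal ∂m

/-- `d`-dimensional strongly rectifiable space. -/
def StronglyRectifiable [MetricSpace X] [MeasurableSpace X] (m : Measure X) (d : ℕ) : Prop :=
  ∀ ε : ℝ, 0 < ε →
    ∃ (U : ℕ → Set X) (φ : ℕ → X → EuclideanSpace ℝ (Fin d)) (c : ℕ → ℝ≥0),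
      (∀ i, MeasurableSet (U i)) ∧
      Pairwise (Function.onFun Disjoint U) ∧
      m (Set.univ \ ⋃ i, U i) = 0 ∧
      ∀ i, 0 < c i ∧ Measurable (φ i) ∧
        (∀ x ∈ U i, ∀ y ∈ U i,
          dist x y ≤ (1 + ε) * dist (φ i x) (φ i y) ∧
          dist (φ i x) (φ i y) ≤ (1 + ε) * dist x y) ∧
        ((c i : ℝ≥0∞) • MeasureTheory.volume.restrict (φ i '' U i) ≤
            Measure.map (φ i) (m.restrict (U i))) ∧
        Measure.map (φ i) (m.restrict (U i)) ≤
          (ENNReal.ofReal (1 + ε) * (c i : ℝ≥0∞)) • MeasureTheory.volume.restrict (φ i '' U i)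

/-! ### Test plans, weak upper gradients, Sobolev spaces -/

/-- `S` is an upper speed for the curve `γ` on `[0,1]`. -/
def UpperSpeed [PseudoMetricSpace X] (γ : ℝ → X) (S : ℝ → ℝ) : Prop :=
  ∀ s t : ℝ, 0 ≤ s → s ≤ t → t ≤ 1 → dist (γ s) (γ t) ≤ ∫ r in s..t, S r

/-- `π` is a test plan with (upper bound for the) speed given by `S`. -/
def IsTestPlan [PseudoMetricSpace X] [MeasurableSpace X] (m : Measure X)
    (π : Measure (ℝ → X)) (S : (ℝ → X) → ℝ → ℝ) : Prop :=
  IsProbabilityMeasure π ∧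
  (∀ᵐ γ ∂π, ContinuousOn γ (Set.Icc 0 1)) ∧
  (∃ C : ℝ≥0, 0 < C ∧ ∀ t ∈ Set.Icc (0:ℝ) 1,
      Measure.map (fun γ => γ t) π ≤ (C : ℝ≥0∞) • m) ∧
  (∀ᵐ γ ∂π, UpperSpeed γ (S γ)) ∧
  (∫⁻ γ, (∫⁻ t in Set.Icc (0:ℝ) 1, ENNReal.ofReal ((S γ t) ^ 2)) ∂π) < ⊤

/-- `G` is a ($2$-)weak upper gradient of `f`. -/
def IsWUG [PseudoMetricSpace X] [MeasurableSpace X] (m : Measure X) (f G : X → ℝ) : Prop :=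
  Measurable G ∧ (∀ x, 0 ≤ G x) ∧ (∫⁻ x, ENNReal.ofReal ((G x) ^ 2) ∂m) < ⊤ ∧
  ∀ (π : Measure (ℝ → X)) (S : (ℝ → X) → ℝ → ℝ), IsTestPlan m π S →
    (∫⁻ γ, ENNReal.ofReal |f (γ 1) - f (γ 0)| ∂π) ≤
      ∫⁻ γ, (∫⁻ t in Set.Icc (0:ℝ) 1, ENNReal.ofReal (G (γ t) * S γ t)) ∂π

/-- Membership in the Sobolev space `W^{1,2}`. -/
def MemW12 [PseudoMetricSpace X] [MeasurableSpace X] (m : Measure X) (f : X → ℝ) : Prop :=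
  Measurable f ∧ (∫⁻ x, ENNReal.ofReal ((f x) ^ 2) ∂m) < ⊤ ∧ ∃ G, IsWUG m f G

/-- `G` is the minimal weak upper gradient of `f`. -/
def IsMinimalWUG [PseudoMetricSpace X] [MeasurableSpace X] (m : Measure X) (f G : X → ℝ) :
    Prop :=
  IsWUG m f G ∧ ∀ G', IsWUG m f G' → ∀ᵐ x ∂m, G x ≤ G' x

/-- Square of the `W^{1,2}` norm: `∫ f² + ∫ |Df|²` (the latter as infimum over
weak upper gradients). -/
def W12Norm2 [PseudoMetricSpace X] [MeasurableSpace X] (m : Measure X) (f : X → ℝ) : ℝ≥0∞ :=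
  (∫⁻ x, ENNReal.ofReal ((f x) ^ 2) ∂m) +
    ⨅ G : {G : X → ℝ // IsWUG m f G}, ∫⁻ x, ENNReal.ofReal ((G.1 x) ^ 2) ∂m

/-- Infinitesimal Hilbertianity: the `W^{1,2}` norm satisfies the parallelogram identity. -/
def InfHilbertian [PseudoMetricSpace X] [MeasurableSpace X] (m : Measure X) : Prop :=
  ∀ f g : X → ℝ, MemW12 m f → MemW12 m g →
    W12Norm2 m (f + g) + W12Norm2 m (f - g) = 2 * W12Norm2 m f + 2 * W12Norm2 m g

/-- The restriction of a function to a subset, as a function on the subtype. -/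
def restrFun (Ω : Set X) (f : X → ℝ) : Ω → ℝ := fun x => f x.1

/-- The measure induced on a subset. -/
def subMeasure [MeasurableSpace X] (m : Measure X) (Ω : Set X) : Measure Ω :=
  Measure.comap Subtype.val m

/-- Membership in `W^{1,2}(Ω)`. -/
def MemW12On [MetricSpace X] [MeasurableSpace X] (m : Measure X) (Ω : Set X) (f : X → ℝ) :
    Prop :=
  MemW12 (subMeasure m Ω) (restrFun Ω f)

/-- Squared `W^{1,2}(Ω)`-distance between two functions. -/
def W12DistSq [MetricSpace X] [MeasurableSpace X] (m : Measure X) (Ω : Set X) (f g : X → ℝ) :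
    ℝ≥0∞ :=
  W12Norm2 (subMeasure m Ω) (restrFun Ω f - restrFun Ω g)

/-- Membership in `W^{1,2}_0(Ω)`: the `W^{1,2}(Ω)`-closure of Sobolev functions with
support contained in `Ω`. -/
def MemW120 [MetricSpace X] [MeasurableSpace X] (m : Measure X) (Ω : Set X) (f : X → ℝ) :
    Prop :=
  MemW12On m Ω f ∧ ∀ ε : ℝ≥0∞, 0 < ε → ∃ g : X → ℝ,
    MemW12On m Ω g ∧ closure (Function.support g) ⊆ Ω ∧ W12DistSq m Ω f g < ε

/-! ### Korevaar–Schoen energies -/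

/-- Borel measurability of a map. -/
def BorelMeas [MeasurableSpace X] [TopologicalSpace Y] (u : X → Y) : Prop :=
  ∀ s : Set Y, IsOpen s → MeasurableSet (u ⁻¹' s)

section KS

variable [MetricSpace X] [MeasurableSpace X] [PseudoMetricSpace Y]

/-- The approximate energy `ks_{2,r}[u,Ω]`. -/
def ks2r (m : Measure X) (Ω : Set X) (u : X → Y) (r : ℝ) (x : X) : ℝ :=
  if Metric.ball x r ⊆ Ω then
    Real.sqrt (⨍ y in Metric.ball x r, dist (u x) (u y) ^ 2 / r ^ 2 ∂m)
  else 0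

/-- The squared approximate energy, `ℝ≥0∞`-valued. -/
def eks2r (m : Measure X) (Ω : Set X) (u : X → Y) (r : ℝ) (x : X) : ℝ≥0∞ :=
  if Metric.ball x r ⊆ Ω then
    (m (Metric.ball x r))⁻¹ *
      ∫⁻ y in Metric.ball x r, (edist (u x) (u y)) ^ 2 / (ENNReal.ofReal r) ^ 2 ∂m
  else 0

/-- The set `Ω_{v,w,α,x}` of points where `v` or `w` moves at least `α` away from its
value at `x`. -/
def badSet (Ω : Set X) (v w : X → Y) (α : ℝ) (x : X) : Set X :=
  {y ∈ Ω | α ≤ dist (v x) (v y) ∨ α ≤ dist (w x) (w y)}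

/-- The modified approximate energy `ks_{2,r}[u,Ω;v,w,α]`. -/
def ks2rMod (m : Measure X) (Ω : Set X) (u v w : X → Y) (α : ℝ) (r : ℝ) (x : X) : ℝ :=
  if Metric.ball x r ⊆ Ω then
    Real.sqrt ((m (Metric.ball x r)).toReal⁻¹ *
      ∫ y in Metric.ball x r \ badSet Ω v w α x, dist (u x) (u y) ^ 2 / r ^ 2 ∂m)
  else 0

/-- Membership in `L²(Ω, Y_o)`. -/
def MemL2 (m : Measure X) (Ω : Set X) (o : Y) (u : X → Y) : Prop :=
  BorelMeas u ∧ TopologicalSpace.IsSeparable (u '' Ω) ∧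
    (∫⁻ x in Ω, ENNReal.ofReal (dist (u x) o ^ 2) ∂m) < ⊤

/-- The Korevaar–Schoen energy `E_2^Ω(u)`. -/
def ksEnergy (m : Measure X) (Ω : Set X) (u : X → Y) : ℝ≥0∞ :=
  Filter.liminf (fun r : ℝ => ∫⁻ x in Ω, ENNReal.ofReal ((ks2r m Ω u r x) ^ 2) ∂m)
    (𝓝[>] (0:ℝ))

/-- Membership in the Korevaar–Schoen space `KS^{1,2}(Ω, Y_o)`. -/
def MemKS (m : Measure X) (Ω : Set X) (o : Y) (u : X → Y) : Prop :=
  MemL2 m Ω o u ∧ ksEnergy m Ω u < ⊤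

/-- `e` is the energy density `e_2[u]` of `u`: the approximate energies converge to it
`m`-a.e. on `Ω` and in `L²(Ω)` as `r ↓ 0`. -/
def IsEnergyDensity (m : Measure X) (Ω : Set X) (u : X → Y) (e : X → ℝ) : Prop :=
  (∀ᵐ x ∂m.restrict Ω,
    Filter.Tendsto (fun r => ks2r m Ω u r x) (𝓝[>] (0:ℝ)) (𝓝 (e x))) ∧
  Filter.Tendsto (fun r => ∫⁻ x in Ω, ENNReal.ofReal ((ks2r m Ω u r x - e x) ^ 2) ∂m)
    (𝓝[>] (0:ℝ)) (𝓝 0)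

/-- The `L²(Ω)`-distance between two maps. -/
def dL2 (m : Measure X) (Ω : Set X) (u v : X → Y) : ℝ≥0∞ :=
  (∫⁻ x in Ω, (edist (u x) (v x)) ^ 2 ∂m) ^ (1/2 : ℝ)

end KS

/-! ### Geodesics and CAT(κ) spaces -/

/-- A geodesic parametrized (proportionally to arc length) on `[0,1]`. -/
def IsGeodesic [PseudoMetricSpace Y] (γ : ℝ → Y) : Prop :=
  ∀ s ∈ Set.Icc (0:ℝ) 1, ∀ t ∈ Set.Icc (0:ℝ) 1,
    dist (γ s) (γ t) = |s - t| * dist (γ 0) (γ 1)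

/-- Every pair of points is joined by a geodesic. -/
def GeodesicSpace (Y : Type*) [PseudoMetricSpace Y] : Prop :=
  ∀ x y : Y, ∃ γ : ℝ → Y, IsGeodesic γ ∧ γ 0 = x ∧ γ 1 = y

/-- Diameter `D_κ` of the model space `M_κ`. -/
def modelDiam (κ : ℝ) : ℝ≥0∞ :=
  if 0 < κ then ENNReal.ofReal (Real.pi / Real.sqrt κ) else ⊤

/-- Inverse hyperbolic cosine. -/
def arcosh (x : ℝ) : ℝ := Real.log (x + Real.sqrt (x ^ 2 - 1))

/-- Cosine of the angle at the vertex between the sides of lengths `a` and `c` of a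
comparison triangle in `M_κ` with side lengths `a`, `b`, `c` (`b` being the side
opposite to the vertex), from the law of cosines in `M_κ`. -/
def modelCosAngle (κ a b c : ℝ) : ℝ :=
  if 0 < κ then
    (Real.cos (Real.sqrt κ * b) - Real.cos (Real.sqrt κ * a) * Real.cos (Real.sqrt κ * c)) /
      (Real.sin (Real.sqrt κ * a) * Real.sin (Real.sqrt κ * c))
  else if κ = 0 then (a ^ 2 + c ^ 2 - b ^ 2) / (2 * a * c)
  else
    (Real.cosh (Real.sqrt (-κ) * a) * Real.cosh (Real.sqrt (-κ) * c) -
        Real.cosh (Real.sqrt (-κ) * b)) /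
      (Real.sinh (Real.sqrt (-κ) * a) * Real.sinh (Real.sqrt (-κ) * c))

/-- In a comparison triangle `p̄ q̄ r̄` in `M_κ` with `d(p̄,q̄) = a`, `d(p̄,r̄) = b`,
`d(q̄,r̄) = c`, the distance from `p̄` to the point on the side `q̄ r̄` at arc length `s`
from `q̄`. -/
def modelDist (κ a b c s : ℝ) : ℝ :=
  if 0 < κ then
    (1 / Real.sqrt κ) *
      Real.arccos (Real.cos (Real.sqrt κ * a) * Real.cos (Real.sqrt κ * s) +
        Real.sin (Real.sqrt κ * a) * Real.sin (Real.sqrt κ * s) * modelCosAngle κ a b c)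
  else if κ = 0 then
    Real.sqrt (a ^ 2 + s ^ 2 - 2 * a * s * modelCosAngle κ a b c)
  else
    (1 / Real.sqrt (-κ)) *
      arcosh (Real.cosh (Real.sqrt (-κ) * a) * Real.cosh (Real.sqrt (-κ) * s) -
        Real.sinh (Real.sqrt (-κ) * a) * Real.sinh (Real.sqrt (-κ) * s) * modelCosAngle κ a b c)

/-- `Y` is a CAT(κ) space: a complete geodesic space in which every (nondegenerate)
geodesic triangle of perimeter `< 2 D_κ` is at least as thin as its comparison triangle
in the model space `M_κ`. -/
def IsCAT (κ : ℝ) (Y : Type*) [MetricSpace Y] : Prop :=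
  GeodesicSpace Y ∧
  ∀ (p : Y) (γ : ℝ → Y), IsGeodesic γ →
    0 < dist p (γ 0) → 0 < dist (γ 0) (γ 1) →
    ENNReal.ofReal (dist p (γ 0) + dist p (γ 1) + dist (γ 0) (γ 1)) < 2 * modelDiam κ →
    ∀ t ∈ Set.Icc (0:ℝ) 1,
      dist p (γ t) ≤
        modelDist κ (dist p (γ 0)) (dist p (γ 1)) (dist (γ 0) (γ 1))
          (t * dist (γ 0) (γ 1))

/-- `mid` is the midpoint of a geodesic from `a` to `b`. -/
def IsGeodMidpoint [PseudoMetricSpace Y] (a b mid : Y) : Prop :=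
  ∃ γ : ℝ → Y, IsGeodesic γ ∧ γ 0 = a ∧ γ 1 = b ∧ γ (1/2) = mid

/-- `p` is the point at parameter `t` on a geodesic from `a` to `b`. -/
def IsGeodInterp [PseudoMetricSpace Y] (a b : Y) (t : ℝ) (p : Y) : Prop :=
  ∃ γ : ℝ → Y, IsGeodesic γ ∧ γ 0 = a ∧ γ 1 = b ∧ γ t = p

/-! ### The Dirichlet energy functional -/

/-- `u` belongs to `KS^{1,2}_{ū}(Ω, T)`: a Korevaar–Schoen map with values in `T`
whose "boundary value" agrees with that of `ū`. -/
def KSuSetIn [MetricSpace X] [MeasurableSpace X] [PseudoMetricSpace Y]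
    (m : Measure X) (Ω : Set X) (o : Y) (T : Set Y) (ubar u : X → Y) : Prop :=
  (∀ x ∈ Ω, u x ∈ T) ∧ MemKS m Ω o u ∧
    MemW120 m Ω (fun x => dist (u x) (ubar x))

/-- The functional `E^Ω_{2,ū}` (equal to the energy on `KS^{1,2}_{ū}` and `+∞` elsewhere). -/
def EFunIn [MetricSpace X] [MeasurableSpace X] [PseudoMetricSpace Y]
    (m : Measure X) (Ω : Set X) (o : Y) (T : Set Y) (ubar u : X → Y) : ℝ≥0∞ :=
  if KSuSetIn m Ω o T ubar u then ksEnergy m Ω u else ⊤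



abbrev Linf := lp (fun _ : ℕ => ℝ) ∞

lemma linf_coord_lip {T : Type*} [PseudoMetricSpace T] {K : ℝ≥0} {γ : T → Linf} (h : LipschitzWith K γ) (n : ℕ) :
    LipschitzWith K (fun t => γ t n) := by
  apply LipschitzWith.of_dist_le_mul
  intro s t
  refine le_trans ?_ (h.dist_le_mul s t)
  rw [Real.dist_eq, dist_eq_norm]
  have := lp.norm_apply_le_norm (p := ∞) (by simp) (γ s - γ t) n
  simpa using this

lemma metric_deriv {K : ℝ≥0} {γ : ℝ → Linf} (h : LipschitzWith K γ) :
    ∀ᵐ t : ℝ, ∃ l : ℝ, Tendsto (fun r : ℝ => ‖γ (t + r) - γ t‖ / r) (𝓝[>] 0) (𝓝 l) := by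
  set N : ℝ → ℝ := fun t => ⨆ n : ℕ, |deriv (fun s => γ s n) t| with hN
  have hb : ∀ t n, |deriv (fun s => γ s n) t| ≤ K := fun t n => by
    have := norm_deriv_le_of_lipschitz (x₀ := t) (linf_coord_lip h n)
    simpa using this
  have hbdd : ∀ t, BddAbove (range fun n : ℕ => |deriv (fun s => γ s n) t|) := fun t =>
    ⟨K, by rintro _ ⟨n, rfl⟩; exact hb t n⟩
  have hmeas : Measurable N := by
    apply Measurable.iSup
    intro n
    exact (measurable_deriv _).abs
  have hN0 : ∀ t, 0 ≤ N t := fun t => Real.iSup_nonneg fun n => abs_nonneg _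
  have hNK : ∀ t, N t ≤ K := fun t => ciSup_le (hb t)
  have hloc : LocallyIntegrable N volume := by
    have : MemLp N ∞ volume := memLp_top_of_bound hmeas.aestronglyMeasurable K
      (Eventually.of_forall fun t => by rw [Real.norm_of_nonneg (hN0 t)]; exact hNK t)
    exact this.locallyIntegrable le_top
  have hint : ∀ a b, IntervalIntegrable N volume a b := fun a b =>
    (hloc.integrableOn_isCompact isCompact_uIcc).intervalIntegrable
  have hbound : ∀ t r : ℝ, 0 ≤ r → ‖γ (t + r) - γ t‖ ≤ ∫ s in t..(t+r), N s := by
    intro t r hr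
    refine lp.norm_le_of_forall_le ?_ ?_
    · exact intervalIntegral.integral_nonneg (by linarith) fun s _ => hN0 s
    intro n
    have hac : AbsolutelyContinuousOnInterval (fun s => γ s n) t (t+r) :=
      ((linf_coord_lip h n).lipschitzOnWith).absolutelyContinuousOnInterval
    have hftc := hac.integral_deriv_eq_sub
    have : (γ (t+r) - γ t) n = γ (t+r) n - γ t n := by simp
    rw [this, ← hftc]
    refine intervalIntegral.norm_integral_le_of_norm_le (by linarith) ?_ (hint _ _)
    refine Eventually.of_forall fun s _ => ?_
    rw [Real.norm_eq_abs]
    exact le_ciSup (hbdd s) n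
  have hdiff : ∀ᵐ t : ℝ, ∀ n : ℕ, DifferentiableAt ℝ (fun s => γ s n) t :=
    ae_all_iff.2 fun n => (linf_coord_lip h n).ae_differentiableAt_real
  filter_upwards [hdiff, _root_.LocallyIntegrable.ae_hasDerivAt_integral hloc] with t ht hL
  refine ⟨N t, ?_⟩
  have hd : HasDerivAt (fun y => ∫ s in t..y, N s) (N t) t := hL t
  have hup : Tendsto (fun r : ℝ => (∫ s in t..(t+r), N s) / r) (𝓝[>] 0) (𝓝 (N t)) := by
    have := hd.tendsto_slope_zero_right
    simpa [div_eq_inv_mul] using this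
  rw [tendsto_order]
  constructor
  · intro a ha
    obtain ⟨n, hn⟩ := exists_lt_of_lt_ciSup ha
    have h1 := ((ht n).hasDerivAt.tendsto_slope_zero_right).abs
    filter_upwards [(tendsto_order.1 h1).1 a hn, self_mem_nhdsWithin] with r hr (hr0 : 0 < r)
    refine hr.trans_le ?_
    rw [smul_eq_mul, abs_mul, abs_of_pos (inv_pos.2 hr0), div_eq_inv_mul]
    gcongr
    have := lp.norm_apply_le_norm (p := ∞) (by simp) (γ (t+r) - γ t) n
    simpa using this
  · intro b hb'
    filter_upwards [(tendsto_order.1 hup).2 b hb', self_mem_nhdsWithin] with r hr (hr0 : 0 < r)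
    refine lt_of_le_of_lt ?_ hr
    gcongr
    exact hbound t r hr0.le


/-- limits at `0+` of continuous functions are detected on rationals -/
lemma tendsto_of_rat {g : ℝ → ℝ} (hg : ContinuousOn g (Ioi 0)) {l : ℝ}
    (h : Tendsto (fun q : ℚ => g q) (comap (fun q : ℚ => (q:ℝ)) (𝓝[>] 0)) (𝓝 l)) :
    Tendsto g (𝓝[>] 0) (𝓝 l) := by
  rw [Metric.tendsto_nhds] at h ⊢
  intro ε hε
  have h1 := h (ε/2) (by positivity)
  rw [eventually_comap, eventually_nhdsWithin_iff, Metric.eventually_nhds_iff] at h1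
  obtain ⟨δ, hδ, h1⟩ := h1
  rw [eventually_nhdsWithin_iff, Metric.eventually_nhds_iff]
  refine ⟨δ, hδ, fun r hr hr0 => ?_⟩
  have hr0' : (0:ℝ) < r := hr0
  have hc : ContinuousAt g r := hg.continuousAt (Ioi_mem_nhds hr0')
  have h2 : ∀ᶠ s in 𝓝 r, dist (g s) (g r) < ε/2 := Metric.tendsto_nhds.1 hc _ (by positivity)
  have h3 : ∀ᶠ s in 𝓝 r, 0 < s ∧ dist s 0 < δ := by
    refine (eventually_gt_nhds hr0').and ?_
    exact (isOpen_lt (by fun_prop) continuous_const).mem_nhds hr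
  obtain ⟨q, hq⟩ := (Rat.isDenseEmbedding_coe_real.dense.inter_nhds_nonempty (h2.and h3))
  obtain ⟨⟨q', rfl⟩, hq2, hq3, hq4⟩ := hq
  have h5 := h1 hq4 hq3 q' rfl
  calc dist (g r) l ≤ dist (g r) (g q') + dist (g q') l := dist_triangle _ _ _
    _ < ε := by rw [dist_comm (g r)]; linarith

section secV
variable {V : Type*} [NormedAddCommGroup V] [InnerProductSpace ℝ V] [FiniteDimensional ℝ V]
  [MeasurableSpace V] [BorelSpace V]

lemma dir_deriv {K : ℝ≥0} {F : V → Linf} (h : LipschitzWith K F) (v : V) :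
    ∀ᵐ z : V, ∃ l : ℝ, Tendsto (fun r : ℝ => ‖F (z + r • v) - F z‖ / r) (𝓝[>] 0) (𝓝 l) := by
  let L : ℝ →L[ℝ] V := ContinuousLinearMap.smulRight (1 : ℝ →L[ℝ] ℝ) v
  have hFc := h.continuous
  have hset : {z : V | ∃ l : ℝ, Tendsto (fun r : ℝ => ‖F (z + r • v) - F z‖ / r) (𝓝[>] 0) (𝓝 l)}
      = {z : V | ∃ l : ℝ, Tendsto (fun q : ℚ => ‖F (z + (q:ℝ) • v) - F z‖ / (q:ℝ))
        (comap (fun q : ℚ => (q:ℝ)) (𝓝[>] 0)) (𝓝 l)} := by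
    ext z
    constructor
    · rintro ⟨l, hl⟩
      exact ⟨l, hl.comp tendsto_comap⟩
    · rintro ⟨l, hl⟩
      refine ⟨l, tendsto_of_rat (g := fun r : ℝ => ‖F (z + r • v) - F z‖ / r) ?_ hl⟩
      refine ContinuousOn.div (by fun_prop) (by fun_prop) ?_
      intro r hr
      exact (ne_of_gt hr)
  refine ae_mem_of_ae_add_linearMap_mem L.toLinearMap volume volume
    (s := {z : V | ∃ l : ℝ, Tendsto (fun r : ℝ => ‖F (z + r • v) - F z‖ / r) (𝓝[>] 0) (𝓝 l)}) ?_ ?_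
  · rw [hset]
    refine measurableSet_exists_tendsto (fun q => ?_)
    apply Continuous.measurable
    fun_prop
  intro p
  have := metric_deriv (h.comp ((LipschitzWith.const p).add L.lipschitz))
  filter_upwards [this] with s hs
  obtain ⟨l, hl⟩ := hs
  refine ⟨l, hl.congr fun r => ?_⟩
  simp [L, add_smul, add_assoc]

lemma all_dir_deriv {K : ℝ≥0} {F : V → Linf} (h : LipschitzWith K F) :
    ∀ᵐ z : V, ∀ v : V, ∃ l : ℝ, Tendsto (fun r : ℝ => ‖F (z + r • v) - F z‖ / r) (𝓝[>] 0) (𝓝 l) := by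
  have : ∀ᵐ z : V, ∀ n : ℕ, ∃ l : ℝ, Tendsto
      (fun r : ℝ => ‖F (z + r • TopologicalSpace.denseSeq V n) - F z‖ / r) (𝓝[>] 0) (𝓝 l) :=
    ae_all_iff.2 fun n => dir_deriv h _
  filter_upwards [this] with z hz v
  apply cauchy_map_iff_exists_tendsto.1
  rw [Metric.cauchy_iff]
  refine ⟨by infer_instance, fun ε hε => ?_⟩
  obtain ⟨n, hw⟩ := (TopologicalSpace.denseRange_denseSeq V).exists_mem_open
      (isOpen_ball (x := v) (ε := ε / (4 * (K + 1)))) ⟨v, by apply mem_ball_self; positivity⟩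
  set w := TopologicalSpace.denseSeq V n
  obtain ⟨l, hl⟩ := hz n
  refine ⟨ball l (ε/2), ?_, ?_⟩
  · rw [mem_map]
    filter_upwards [Metric.tendsto_nhds.1 hl (ε/4) (by positivity), self_mem_nhdsWithin]
      with r hr (hr0 : 0 < r)
    have h1 : dist (‖F (z + r • v) - F z‖ / r) (‖F (z + r • w) - F z‖ / r) ≤ ε / 4 := by
      rw [Real.dist_eq, ← sub_div, abs_div, abs_of_pos hr0, div_le_iff₀ hr0]
      have h2 := abs_norm_sub_norm_le (F (z + r • v) - F z) (F (z + r • w) - F z)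
      refine h2.trans ?_
      rw [sub_sub_sub_cancel_right]
      refine (h.norm_sub_le _ _).trans ?_
      rw [add_sub_add_left_eq_sub, ← smul_sub, norm_smul, Real.norm_of_nonneg hr0.le]
      rw [mem_ball, dist_comm, dist_eq_norm, lt_div_iff₀ (by positivity)] at hw
      nlinarith [norm_nonneg (v - w), NNReal.coe_nonneg K, mul_nonneg hr0.le (norm_nonneg (v-w))]
    show dist _ _ < _
    calc _ ≤ _ + _ := dist_triangle _ (‖F (z + r • w) - F z‖ / r) _
      _ < ε/2 := by linarith
  · intro x hx y hy
    rw [mem_ball] at hx hy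
    calc dist x y ≤ dist x l + dist y l := dist_triangle_right _ _ _
      _ < ε := by linarith

lemma lintegral_ball_scale (g : V → ℝ≥0∞) (z : V) {r : ℝ} (hr : 0 < r) :
    ∫⁻ w in ball z r, g w = ENNReal.ofReal (r ^ (Module.finrank ℝ V)) *
      ∫⁻ v in ball (0:V) 1, g (z + r • v) := by
  have hmp : MeasurableEmbedding (fun v : V => z + r • v) :=
    ((Homeomorph.smulOfNeZero r hr.ne').trans (Homeomorph.addLeft z)).measurableEmbedding
  have hmap : Measure.map (fun v : V => z + r • v) volume =
      ENNReal.ofReal (r ^ (Module.finrank ℝ V))⁻¹ • (volume : Measure V) := by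
    have h1 := Measure.map_addHaar_smul (volume : Measure V) hr.ne'
    have h2 : Measure.map (fun v : V => z + r • v) volume =
        Measure.map (fun v => z + v) (Measure.map (fun v : V => r • v) volume) := by
      rw [Measure.map_map (by fun_prop) (by fun_prop)]; rfl
    rw [h2, h1, Measure.map_smul, map_add_left_eq_self]
    rw [abs_of_pos (by positivity)]
  have hpre : (fun v : V => z + r • v) ⁻¹' (ball z r) = ball 0 1 := by
    ext v
    simp [norm_smul, abs_of_pos hr, hr]
  rw [← hpre, ← hmp.lintegral_map, ← hmp.restrict_map, hmap, Measure.restrict_smul,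
    lintegral_smul_measure, smul_eq_mul, ← mul_assoc, ← ENNReal.ofReal_mul (by positivity),
    mul_inv_cancel₀ (by positivity), ENNReal.ofReal_one, one_mul]

lemma ball_energy_tendsto {K : ℝ≥0} {F : V → Linf} (h : LipschitzWith K F) :
    ∀ᵐ z : V, ∃ q : ℝ≥0∞, q ≠ ∞ ∧ Tendsto
      (fun r : ℝ => (∫⁻ w in ball z r, ENNReal.ofReal (‖F w - F z‖ ^ 2)) /
        ENNReal.ofReal (r ^ (Module.finrank ℝ V + 2))) (𝓝[>] 0) (𝓝 q) := by
  filter_upwards [all_dir_deriv h] with z hz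
  choose l hl using hz
  have hFc := h.continuous
  have hbd : ∀ r : ℝ, 0 < r → ∀ v ∈ ball (0:V) 1,
      ENNReal.ofReal ((‖F (z + r • v) - F z‖ / r) ^ 2) ≤ ENNReal.ofReal (K ^ 2) := by
    intro r hr v hv
    apply ENNReal.ofReal_le_ofReal
    apply pow_le_pow_left₀ (by positivity)
    rw [div_le_iff₀ hr]
    refine (h.norm_sub_le _ _).trans ?_
    rw [add_sub_cancel_left, norm_smul, Real.norm_of_nonneg hr.le]
    rw [mem_ball_zero_iff] at hv
    have := NNReal.coe_nonneg K
    gcongr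
    nlinarith
  have hlim : Tendsto (fun r : ℝ => ∫⁻ v in ball (0:V) 1, ENNReal.ofReal ((‖F (z + r • v) - F z‖ / r) ^ 2))
      (𝓝[>] 0) (𝓝 (∫⁻ v in ball (0:V) 1, ENNReal.ofReal (l v ^ 2))) := by
    apply tendsto_lintegral_filter_of_dominated_convergence (fun _ => ENNReal.ofReal (K^2))
    · refine Eventually.of_forall fun r => ?_
      apply ENNReal.measurable_ofReal.comp
      apply Continuous.measurable
      fun_prop
    · filter_upwards [self_mem_nhdsWithin] with r (hr : 0 < r)
      filter_upwards [ae_restrict_mem measurableSet_ball] with v hv using hbd r hr v hv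
    · rw [setLIntegral_const]
      exact ENNReal.mul_ne_top ENNReal.ofReal_ne_top measure_ball_lt_top.ne
    · refine Eventually.of_forall fun v => ?_
      exact (ENNReal.continuous_ofReal.tendsto _).comp ((hl v).pow 2)
  refine ⟨_, ?_, (hlim.congr' ?_)⟩
  · have : ∀ᶠ r in 𝓝[>] (0:ℝ), (∫⁻ v in ball (0:V) 1, ENNReal.ofReal ((‖F (z + r • v) - F z‖ / r) ^ 2))
        ≤ ENNReal.ofReal (K^2) * volume (ball (0:V) 1) := by
      filter_upwards [self_mem_nhdsWithin] with r (hr : 0 < r)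
      rw [← setLIntegral_const]
      exact setLIntegral_mono measurable_const (hbd r hr)
    refine ne_top_of_le_ne_top ?_ (le_of_tendsto hlim this)
    exact ENNReal.mul_ne_top ENNReal.ofReal_ne_top measure_ball_lt_top.ne
  · filter_upwards [self_mem_nhdsWithin] with r (hr : 0 < r)
    rw [lintegral_ball_scale _ _ hr, pow_add, ENNReal.ofReal_mul (by positivity)]
    rw [ENNReal.mul_div_mul_left _ _ (by simpa using by positivity) ENNReal.ofReal_ne_top]
    rw [ENNReal.div_eq_inv_mul, ← lintegral_const_mul' _ _ (by simpa using by positivity)]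
    congr 1
    ext v
    rw [div_pow, ENNReal.ofReal_div_of_pos (by positivity), ENNReal.div_eq_inv_mul]


lemma locFin_of_bdd [MetricSpace X] [MeasurableSpace X] {m : Measure X}
    (hfin : FiniteOnBounded m) : IsLocallyFiniteMeasure m :=
  ⟨fun x => ⟨ball x 1, ball_mem_nhds x one_pos, hfin _ isBounded_ball⟩⟩

lemma unifDoubling [MetricSpace X] [MeasurableSpace X] {m : Measure X}
    (hdoub : LocUnifDoubling m) : IsUnifLocDoublingMeasure m := by
  obtain ⟨C, hC, h⟩ := hdoub 4 (by norm_num)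
  refine ⟨C * C, ?_⟩
  have : ∀ᶠ ε : ℝ in 𝓝[>] 0, 0 < ε ∧ ε < 1 := Ioo_mem_nhdsGT one_pos
  filter_upwards [this] with ε ⟨h0, h1⟩ x
  calc m (closedBall x (2*ε)) ≤ m (ball x (2 * (2 * ε))) := by
        apply measure_mono; apply closedBall_subset_ball; linarith
    _ ≤ C * m (ball x (2 * ε)) := h x _ (by linarith) (by linarith)
    _ ≤ C * (C * m (ball x ε)) := by gcongr; exact h x _ h0 (by linarith)
    _ ≤ C * (C * m (closedBall x ε)) := by gcongr; exact ball_subset_closedBall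
    _ = _ := by push_cast; ring

lemma density_ball [MetricSpace X] [SecondCountableTopology X] [MeasurableSpace X] [BorelSpace X]
    {m : Measure X} [IsLocallyFiniteMeasure m] (hdoub : LocUnifDoubling m) {S : Set X}
    (hS : MeasurableSet S) :
    ∀ᵐ x ∂m, x ∈ S → Tendsto (fun r => m (ball x r \ S) / m (ball x r)) (𝓝[>] (0:ℝ)) (𝓝 0) := by
  haveI := unifDoubling hdoub
  obtain ⟨C, hC, h⟩ := hdoub 1 (by norm_num)
  have hV := (IsUnifLocDoublingMeasure.vitaliFamily m 1).ae_tendsto_measure_inter_div_of_measurableSet hS.compl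
  filter_upwards [hV] with x hx hxS
  have h1 : Tendsto (fun r : ℝ => closedBall x r) (𝓝[>] 0)
      ((IsUnifLocDoublingMeasure.vitaliFamily m 1).filterAt x) := by
    refine IsUnifLocDoublingMeasure.tendsto_closedBall_filterAt m (fun _ => x) (fun r => r) tendsto_id ?_
    filter_upwards [self_mem_nhdsWithin] with r (hr : 0 < r)
    exact mem_closedBall_self (by linarith)
  have h2 := hx.comp h1
  have h3 : indicator Sᶜ (1 : X → ℝ≥0∞) x = 0 := by simp [hxS]
  rw [h3] at h2
  have h4 := ENNReal.Tendsto.const_mul (a := (C : ℝ≥0∞)) h2 (Or.inr ENNReal.coe_ne_top)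
  rw [mul_zero] at h4
  refine tendsto_of_tendsto_of_tendsto_of_le_of_le' tendsto_const_nhds h4
    (Eventually.of_forall fun _ => bot_le) ?_
  have : ∀ᶠ ε : ℝ in 𝓝[>] 0, 0 < ε ∧ ε < 1 := Ioo_mem_nhdsGT one_pos
  filter_upwards [this] with r ⟨h0, h1'⟩
  have hb : m (closedBall x r) ≤ C * m (ball x r) :=
    (measure_mono (closedBall_subset_ball (by linarith))).trans (h x r h0 h1')
  have hC' : (C : ℝ≥0∞) ≠ 0 := by exact_mod_cast hC.ne'
  simp only [Function.comp]
  have hinv : (m (ball x r))⁻¹ ≤ C * (m (closedBall x r))⁻¹ := by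
    calc (m (ball x r))⁻¹ = C * (C * m (ball x r))⁻¹ := by
          rw [ENNReal.mul_inv (Or.inl hC') (Or.inl ENNReal.coe_ne_top), ← mul_assoc,
            ENNReal.mul_inv_cancel hC' ENNReal.coe_ne_top, one_mul]
      _ ≤ _ := by gcongr
  calc m (ball x r \ S) / m (ball x r) ≤ m (Sᶜ ∩ closedBall x r) * (m (ball x r))⁻¹ := by
        rw [ENNReal.div_eq_inv_mul, mul_comm]
        gcongr
        intro y hy
        exact ⟨hy.2, ball_subset_closedBall hy.1⟩
    _ ≤ m (Sᶜ ∩ closedBall x r) * (C * (m (closedBall x r))⁻¹) := by gcongr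
    _ = _ := by rw [ENNReal.div_eq_inv_mul]; ring

lemma doubling_volume (V : Type*) [NormedAddCommGroup V] [InnerProductSpace ℝ V]
    [FiniteDimensional ℝ V] [MeasurableSpace V] [BorelSpace V] :
    LocUnifDoubling (volume : Measure V) := by
  intro R hR
  refine ⟨2 ^ (Module.finrank ℝ V), by positivity, fun x r hr _ => ?_⟩
  rw [Measure.addHaar_ball_mul_of_pos _ x (by norm_num : (0:ℝ) < 2) r, Measure.addHaar_ball_center volume x]
  gcongr
  rw [ENNReal.ofReal_pow (by norm_num)]
  push_cast
  simp

lemma ae_ball_pos [MetricSpace X] [SecondCountableTopology X] [MeasurableSpace X] [BorelSpace X]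
    (m : Measure X) : ∀ᵐ x ∂m, ∀ r : ℝ, 0 < r → 0 < m (ball x r) := by
  filter_upwards [Measure.support_mem_ae (μ := m)] with x hx r hr
  exact (Measure.mem_support_iff_forall x).1 hx _ (ball_mem_nhds x hr)

lemma sandwich_real (d : ℕ) {lam c ω q L K : ℝ} (hlam : 1 ≤ lam) (hc : 0 < c) (hω : 0 < ω)
    {I b M V W J : ℝ → ℝ}
    (hb : ∀ᶠ r in 𝓝[>] (0:ℝ), 0 < b r)
    (hJ0 : ∀ r, 0 ≤ J r) (hW0 : ∀ r, 0 ≤ W r) (hV0 : ∀ r, 0 ≤ V r)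
    (hI1 : ∀ᶠ r in 𝓝[>] (0:ℝ), I r ≤ lam * c * J (lam * r) + L * r ^ 2 * M r)
    (hb1 : ∀ᶠ r in 𝓝[>] (0:ℝ), c * V (r / lam) ≤ b r)
    (hI2 : ∀ᶠ r in 𝓝[>] (0:ℝ), c * J (r / lam) ≤ I r + K * r ^ 2 * M r + c * K * r ^ 2 * W (r / lam))
    (hb2 : ∀ᶠ r in 𝓝[>] (0:ℝ), b r ≤ lam * c * (ω * (lam * r) ^ d) + M r)
    (hK : 0 ≤ K)
    (hM : Tendsto (fun r => M r / b r) (𝓝[>] 0) (𝓝 0))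
    (hV : Tendsto (fun r => V r / r ^ d) (𝓝[>] 0) (𝓝 ω))
    (hW : Tendsto (fun r => W r / r ^ d) (𝓝[>] 0) (𝓝 0))
    (hJ : Tendsto (fun r => J r / r ^ (d + 2)) (𝓝[>] 0) (𝓝 q)) :
    ∃ Up Lw : ℝ → ℝ, Tendsto Up (𝓝[>] 0) (𝓝 (lam ^ (2 * d + 3) * (q / ω))) ∧
      Tendsto Lw (𝓝[>] 0) (𝓝 ((lam ^ (2 * d + 3))⁻¹ * (q / ω))) ∧
      (∀ᶠ r in 𝓝[>] (0:ℝ), I r / (b r * r ^ 2) ≤ Up r) ∧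
      (∀ᶠ r in 𝓝[>] (0:ℝ), Lw r ≤ I r / (b r * r ^ 2)) := by
  have hl0 : 0 < lam := by linarith
  have t1 : Tendsto (fun r : ℝ => lam * r) (𝓝[>] 0) (𝓝[>] 0) := by
    refine tendsto_nhdsWithin_iff.2 ⟨?_, ?_⟩
    · have : Tendsto (fun r : ℝ => lam * r) (𝓝 0) (𝓝 (lam * 0)) := (continuous_const.mul continuous_id).tendsto 0
      rw [mul_zero] at this
      exact this.mono_left nhdsWithin_le_nhds
    · filter_upwards [self_mem_nhdsWithin] with r (hr : 0 < r)
      exact mul_pos hl0 hr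
  have t2 : Tendsto (fun r : ℝ => r / lam) (𝓝[>] 0) (𝓝[>] 0) := by
    refine tendsto_nhdsWithin_iff.2 ⟨?_, ?_⟩
    · have : Tendsto (fun r : ℝ => r / lam) (𝓝 0) (𝓝 (0 / lam)) := (continuous_id.div_const lam).tendsto 0
      rw [zero_div] at this
      exact this.mono_left nhdsWithin_le_nhds
    · filter_upwards [self_mem_nhdsWithin] with r (hr : 0 < r)
      exact div_pos hr hl0
  have hVpos : ∀ᶠ r in 𝓝[>] (0:ℝ), 0 < V (r / lam) / (r / lam) ^ d :=
    (hV.comp t2).eventually (lt_mem_nhds hω)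
  refine ⟨fun r => lam ^ (2 * d + 3) * ((J (lam * r) / (lam * r) ^ (d + 2)) / (V (r / lam) / (r / lam) ^ d))
      + L * (M r / b r),
    fun r => (lam ^ (2 * d + 3))⁻¹ * ((J (r / lam) / (r / lam) ^ (d + 2)) / ω) * (1 - M r / b r)
      - K * (M r / b r) - K * ((W (r / lam) / (r / lam) ^ d) / (V (r / lam) / (r / lam) ^ d)), ?_, ?_, ?_, ?_⟩
  · have := (((hJ.comp t1).div (hV.comp t2) hω.ne').const_mul (lam ^ (2 * d + 3))).add (hM.const_mul L)
    simpa using this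
  · have := (((((hJ.comp t2).div_const ω).const_mul (lam ^ (2 * d + 3))⁻¹).mul (hM.const_sub 1)).sub
      (hM.const_mul K)).sub (((hW.comp t2).div (hV.comp t2) hω.ne').const_mul K)
    simpa using this
  · filter_upwards [hb, hI1, hb1, hVpos, self_mem_nhdsWithin] with r hb hI1 hb1 hVp (hr : 0 < r)
    have hVr : 0 < V (r / lam) := by
      by_contra hcon
      have : V (r/lam) = 0 := le_antisymm (not_lt.1 hcon) (hV0 _)
      simp [this] at hVp
    have e1 : lam ^ (2 * d + 3) * ((J (lam * r) / (lam * r) ^ (d + 2)) / (V (r / lam) / (r / lam) ^ d))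
        = lam * c * J (lam * r) / (c * V (r / lam) * r ^ 2) := by
      generalize V (r / lam) = v at *
      generalize J (lam * r) = j at *
      rw [div_pow, mul_pow]
      field_simp
      try ring
    rw [e1]
    calc I r / (b r * r ^ 2) ≤ (lam * c * J (lam * r) + L * r ^ 2 * M r) / (b r * r ^ 2) := by gcongr
      _ = lam * c * J (lam * r) / (b r * r ^ 2) + L * (M r / b r) := by field_simp
      _ ≤ _ := by
        gcongr
        have := hJ0 (lam * r)
        positivity
  · filter_upwards [hb, hI2, hb1, hb2, hVpos, self_mem_nhdsWithin] with r hb hI2 hb1 hb2 hVp (hr : 0 < r)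
    have hVr : 0 < V (r / lam) := by
      by_contra hcon
      have : V (r/lam) = 0 := le_antisymm (not_lt.1 hcon) (hV0 _)
      simp [this] at hVp
    have hJr := hJ0 (r / lam)
    have hWr := hW0 (r / lam)
    have e1 : K * ((W (r / lam) / (r / lam) ^ d) / (V (r / lam) / (r / lam) ^ d))
        = c * K * r ^ 2 * W (r / lam) / (c * V (r / lam) * r ^ 2) := by
      field_simp
    have e2 : c * K * r ^ 2 * W (r / lam) / (b r * r ^ 2) ≤
        c * K * r ^ 2 * W (r / lam) / (c * V (r / lam) * r ^ 2) := by gcongr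
    have e3 : (lam ^ (2 * d + 3))⁻¹ * ((J (r / lam) / (r / lam) ^ (d + 2)) / ω) * (1 - M r / b r)
        ≤ c * J (r / lam) / (b r * r ^ 2) := by
      have h1 : 1 - M r / b r ≤ lam * c * (ω * (lam * r) ^ d) / b r := by
        rw [sub_le_iff_le_add, ← add_div, le_div_iff₀ hb]; linarith
      calc _ ≤ (lam ^ (2 * d + 3))⁻¹ * ((J (r / lam) / (r / lam) ^ (d + 2)) / ω) * (lam * c * (ω * (lam * r) ^ d) / b r) := by
            gcongr
        _ = _ := by
            generalize J (r / lam) = j at *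
            rw [div_pow, mul_pow]
            field_simp
            try ring
    have e4 : c * J (r / lam) / (b r * r ^ 2) ≤ I r / (b r * r ^ 2) + K * (M r / b r)
        + c * K * r ^ 2 * W (r / lam) / (b r * r ^ 2) := by
      calc _ ≤ (I r + K * r ^ 2 * M r + c * K * r ^ 2 * W (r / lam)) / (b r * r ^ 2) := by gcongr
        _ = _ := by field_simp
    linarith


lemma chart_ineqs {W : Type*} [NormedAddCommGroup W] [InnerProductSpace ℝ W]
    [FiniteDimensional ℝ W] [MeasurableSpace W] [BorelSpace W]
    [MetricSpace X] [MeasurableSpace X] [BorelSpace X] {m : Measure X}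
    {U E : Set X} {φ : X → W} {c : ℝ≥0} {lam : ℝ} (hlam : 1 ≤ lam)
    (hU : MeasurableSet U) (hφ : Measurable φ) (hφU : MeasurableSet (φ '' U))
    (hbi : ∀ x ∈ U, ∀ y ∈ U, dist x y ≤ lam * dist (φ x) (φ y) ∧
          dist (φ x) (φ y) ≤ lam * dist x y)
    (hm1 : (c : ℝ≥0∞) • MeasureTheory.volume.restrict (φ '' U) ≤ Measure.map φ (m.restrict U))
    (hm2 : Measure.map φ (m.restrict U) ≤
          (ENNReal.ofReal lam * (c : ℝ≥0∞)) • MeasureTheory.volume.restrict (φ '' U))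
    (hE : MeasurableSet E) {f : X → Linf} {L K : ℝ≥0} (hf : LipschitzOnWith L f E)
    {F : W → Linf} (hF : LipschitzWith K F) (hFf : ∀ x ∈ E ∩ U, F (φ x) = f x)
    {x : X} (hx : x ∈ E ∩ U) {r : ℝ} (hr : 0 < r) :
    (∫⁻ y in ball x r ∩ E, ENNReal.ofReal (‖f x - f y‖ ^ 2) ∂m) ≤
      ENNReal.ofReal lam * c * (∫⁻ z in ball (φ x) (lam * r), ENNReal.ofReal (‖F z - F (φ x)‖ ^ 2)) +
        ENNReal.ofReal (L ^ 2 * r ^ 2) * m (ball x r \ (E ∩ U)) ∧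
    c * volume (ball (φ x) (r / lam) ∩ φ '' U) ≤ m (ball x r) ∧
    c * (∫⁻ z in ball (φ x) (r / lam), ENNReal.ofReal (‖F z - F (φ x)‖ ^ 2)) ≤
      (∫⁻ y in ball x r ∩ E, ENNReal.ofReal (‖f x - f y‖ ^ 2) ∂m) +
        ENNReal.ofReal (K ^ 2 * r ^ 2) * m (ball x r \ (E ∩ U)) +
        c * (ENNReal.ofReal (K ^ 2 * r ^ 2) * volume (ball (φ x) (r / lam) \ φ '' U)) ∧
    m (ball x r) ≤ ENNReal.ofReal lam * c * volume (ball (φ x) (lam * r)) +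
        m (ball x r \ (E ∩ U)) := by
  have hl0 : 0 < lam := by linarith
  set g : W → ℝ≥0∞ := fun z => ENNReal.ofReal (‖F z - F (φ x)‖ ^ 2) with hg
  have hgm : Measurable g := by
    have : Continuous (fun z => ‖F z - F (φ x)‖ ^ 2) := by
      have := hF.continuous
      fun_prop
    exact this.measurable.ennreal_ofReal
  have up : ∀ S : Set W, MeasurableSet S → ∀ h : W → ℝ≥0∞, Measurable h →
      ∫⁻ y in φ ⁻¹' S ∩ U, h (φ y) ∂m ≤ ENNReal.ofReal lam * c * ∫⁻ z in S, h z := by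
    intro S hS h hh
    calc ∫⁻ y in φ ⁻¹' S ∩ U, h (φ y) ∂m = ∫⁻ z in S, h z ∂(Measure.map φ (m.restrict U)) := by
          rw [setLIntegral_map hS hh hφ, Measure.restrict_restrict (hφ hS)]
      _ ≤ ∫⁻ z in S, h z ∂((ENNReal.ofReal lam * (c : ℝ≥0∞)) • volume.restrict (φ '' U)) :=
          lintegral_mono' (Measure.restrict_mono subset_rfl hm2) le_rfl
      _ = ENNReal.ofReal lam * c * ∫⁻ z in S ∩ φ '' U, h z := by
          rw [Measure.restrict_smul, lintegral_smul_measure, Measure.restrict_restrict hS, smul_eq_mul]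
      _ ≤ _ := by gcongr; exact inter_subset_left
  have dn : ∀ S : Set W, MeasurableSet S → ∀ h : W → ℝ≥0∞, Measurable h →
      c * ∫⁻ z in S ∩ φ '' U, h z ≤ ∫⁻ y in φ ⁻¹' S ∩ U, h (φ y) ∂m := by
    intro S hS h hh
    calc c * ∫⁻ z in S ∩ φ '' U, h z = ∫⁻ z in S, h z ∂((c : ℝ≥0∞) • volume.restrict (φ '' U)) := by
          rw [Measure.restrict_smul, lintegral_smul_measure, Measure.restrict_restrict hS, smul_eq_mul]
      _ ≤ ∫⁻ z in S, h z ∂(Measure.map φ (m.restrict U)) :=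
          lintegral_mono' (Measure.restrict_mono subset_rfl hm1) le_rfl
      _ = _ := by
          rw [setLIntegral_map hS hh hφ, Measure.restrict_restrict (hφ hS)]
  have s1 : ball x r ∩ (E ∩ U) ⊆ φ ⁻¹' (ball (φ x) (lam * r)) ∩ U := by
    rintro y ⟨hy, hyE, hyU⟩
    refine ⟨?_, hyU⟩
    rw [mem_preimage, mem_ball]
    rw [mem_ball] at hy
    calc _ ≤ lam * dist y x := (hbi y hyU x hx.2).2
      _ < _ := by gcongr
  have s2 : φ ⁻¹' (ball (φ x) (r / lam)) ∩ U ⊆ ball x r := by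
    rintro y ⟨hy, hyU⟩
    rw [mem_preimage, mem_ball, lt_div_iff₀ hl0] at hy
    rw [mem_ball]
    calc _ ≤ lam * dist (φ y) (φ x) := (hbi y hyU x hx.2).1
      _ < _ := by linarith
  have gG : ∀ y ∈ E ∩ U, g (φ y) = ENNReal.ofReal (‖f x - f y‖ ^ 2) := by
    intro y hy
    simp only [hg]
    rw [hFf y hy, hFf x hx, norm_sub_rev]
  have gb : ∀ z ∈ ball (φ x) (r / lam), g z ≤ ENNReal.ofReal (K ^ 2 * r ^ 2) := by
    intro z hz
    simp only [hg]
    rw [← mul_pow]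
    gcongr
    rw [← dist_eq_norm]
    refine (hF.dist_le_mul _ _).trans ?_
    gcongr
    refine (mem_ball.1 hz).le.trans ?_
    exact div_le_self hr.le hlam
  have hGm : MeasurableSet (E ∩ U) := hE.inter hU
  refine ⟨?_, ?_, ?_, ?_⟩
  · calc (∫⁻ y in ball x r ∩ E, ENNReal.ofReal (‖f x - f y‖ ^ 2) ∂m)
        ≤ ∫⁻ y in (ball x r ∩ (E ∩ U)) ∪ (ball x r ∩ (E \ U)), ENNReal.ofReal (‖f x - f y‖ ^ 2) ∂m := by
          refine lintegral_mono_set ?_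
          rintro y ⟨h1, h2⟩
          by_cases h3 : y ∈ U
          · exact Or.inl ⟨h1, h2, h3⟩
          · exact Or.inr ⟨h1, h2, h3⟩
      _ ≤ _ := lintegral_union_le _ _ _
      _ ≤ _ := by
        gcongr ?_ + ?_
        · calc ∫⁻ y in (ball x r ∩ (E ∩ U)), ENNReal.ofReal (‖f x - f y‖ ^ 2) ∂m
              = ∫⁻ y in (ball x r ∩ (E ∩ U)), g (φ y) ∂m := by
                refine setLIntegral_congr_fun (measurableSet_ball.inter hGm) fun y hy => (gG y hy.2).symm
            _ ≤ ∫⁻ y in φ ⁻¹' (ball (φ x) (lam * r)) ∩ U, g (φ y) ∂m := lintegral_mono_set s1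
            _ ≤ _ := up _ measurableSet_ball _ hgm
        · calc ∫⁻ y in (ball x r ∩ (E \ U)), ENNReal.ofReal (‖f x - f y‖ ^ 2) ∂m
              ≤ ∫⁻ y in (ball x r ∩ (E \ U)), ENNReal.ofReal (L ^ 2 * r ^ 2) ∂m := by
                refine setLIntegral_mono' (measurableSet_ball.inter (hE.diff hU)) fun y hy => ?_
                rw [← mul_pow]
                gcongr
                rw [← dist_eq_norm]
                refine (hf.dist_le_mul _ hx.1 _ hy.2.1).trans ?_
                gcongr
                exact (mem_ball'.1 hy.1).le
            _ = ENNReal.ofReal (L ^ 2 * r ^ 2) * m (ball x r ∩ (E \ U)) := setLIntegral_const _ _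
            _ ≤ _ := by
                gcongr
                rintro y ⟨h1, h2⟩
                exact ⟨h1, fun h => h2.2 h.2⟩
  · have := dn (ball (φ x) (r / lam)) measurableSet_ball 1 measurable_one
    simp only [Pi.one_apply, setLIntegral_one] at this
    exact this.trans (measure_mono s2)
  · calc c * (∫⁻ z in ball (φ x) (r / lam), g z)
        = c * (∫⁻ z in ball (φ x) (r / lam) ∩ φ '' U, g z) + c * (∫⁻ z in ball (φ x) (r / lam) \ φ '' U, g z) := by
          rw [← mul_add, lintegral_inter_add_sdiff _ _ hφU]
      _ ≤ _ := by
        gcongr ?_ + c * ?_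
        · refine (dn _ measurableSet_ball _ hgm).trans ?_
          calc ∫⁻ y in φ ⁻¹' (ball (φ x) (r / lam)) ∩ U, g (φ y) ∂m
              ≤ ∫⁻ y in (ball x r ∩ (E ∩ U)) ∪ ((φ ⁻¹' (ball (φ x) (r / lam)) ∩ U) \ (E ∩ U)), g (φ y) ∂m := by
                refine lintegral_mono_set ?_
                intro y hy
                by_cases h : y ∈ E ∩ U
                · exact Or.inl ⟨s2 hy, h⟩
                · exact Or.inr ⟨hy, h⟩
            _ ≤ _ := lintegral_union_le _ _ _
            _ ≤ _ := by
              gcongr ?_ + ?_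
              · calc _ = ∫⁻ y in (ball x r ∩ (E ∩ U)), ENNReal.ofReal (‖f x - f y‖ ^ 2) ∂m :=
                      setLIntegral_congr_fun (measurableSet_ball.inter hGm) fun y hy => (gG y hy.2)
                  _ ≤ _ := lintegral_mono_set (by gcongr; exact inter_subset_left)
              · calc _ ≤ ∫⁻ y in ((φ ⁻¹' (ball (φ x) (r / lam)) ∩ U) \ (E ∩ U)), ENNReal.ofReal (K ^ 2 * r ^ 2) ∂m :=
                      setLIntegral_mono' (((hφ measurableSet_ball).inter hU).diff hGm) fun y hy => gb _ hy.1.1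
                  _ = _ := setLIntegral_const _ _
                  _ ≤ _ := by gcongr
        · calc _ ≤ ∫⁻ z in ball (φ x) (r / lam) \ φ '' U, ENNReal.ofReal (K ^ 2 * r ^ 2) :=
                setLIntegral_mono' (measurableSet_ball.diff hφU) fun z hz => gb _ hz.1
            _ = _ := setLIntegral_const _ _
  · have := up (ball (φ x) (lam * r)) measurableSet_ball 1 measurable_one
    simp only [Pi.one_apply, setLIntegral_one] at this
    calc m (ball x r) ≤ m (ball x r ∩ (E ∩ U)) + m (ball x r \ (E ∩ U)) := measure_le_inter_add_sdiff _ _ _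
      _ ≤ _ := by
        gcongr
        exact (measure_mono s1).trans this


lemma chart_sandwich {W : Type*} [NormedAddCommGroup W] [InnerProductSpace ℝ W]
    [FiniteDimensional ℝ W] [MeasurableSpace W] [BorelSpace W]
    [MetricSpace X] [CompleteSpace X] [TopologicalSpace.SeparableSpace X]
    [MeasurableSpace X] [BorelSpace X] {m : Measure X}
    (hfin : FiniteOnBounded m) (hdoub : LocUnifDoubling m)
    {U E : Set X} {φ : X → W} {c : ℝ≥0} {lam : ℝ} (hlam : 1 ≤ lam) (hc : 0 < c)
    (hU : MeasurableSet U) (hφ : Measurable φ)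
    (hbi : ∀ x ∈ U, ∀ y ∈ U, dist x y ≤ lam * dist (φ x) (φ y) ∧
          dist (φ x) (φ y) ≤ lam * dist x y)
    (hm1 : (c : ℝ≥0∞) • MeasureTheory.volume.restrict (φ '' U) ≤ Measure.map φ (m.restrict U))
    (hm2 : Measure.map φ (m.restrict U) ≤
          (ENNReal.ofReal lam * (c : ℝ≥0∞)) • MeasureTheory.volume.restrict (φ '' U))
    (hE : MeasurableSet E) {f : X → Linf} {L : ℝ≥0} (hf : LipschitzOnWith L f E) :
    ∀ᵐ x ∂m, x ∈ E → x ∈ U → ∃ Q : ℝ, ∃ Up Lw : ℝ → ℝ,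
      Tendsto Up (𝓝[>] 0) (𝓝 (lam ^ (2 * Module.finrank ℝ W + 3) * Q)) ∧
      Tendsto Lw (𝓝[>] 0) (𝓝 ((lam ^ (2 * Module.finrank ℝ W + 3))⁻¹ * Q)) ∧
      (∀ᶠ r in 𝓝[>] (0:ℝ), (∫⁻ y in ball x r ∩ E, ENNReal.ofReal (‖f x - f y‖ ^ 2) ∂m).toReal /
        ((m (ball x r)).toReal * r ^ 2) ≤ Up r) ∧
      (∀ᶠ r in 𝓝[>] (0:ℝ), Lw r ≤ (∫⁻ y in ball x r ∩ E, ENNReal.ofReal (‖f x - f y‖ ^ 2) ∂m).toReal /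
        ((m (ball x r)).toReal * r ^ 2)) := by
  have hl0 : 0 < lam := by linarith
  have : IsLocallyFiniteMeasure m := locFin_of_bdd hfin
  have : SecondCountableTopology X := UniformSpace.secondCountable_of_separable X
  have : PolishSpace X := inferInstance
  have hinj : InjOn φ U := by
    intro x hx y hy h
    have := (hbi x hx y hy).1
    rw [h, dist_self, mul_zero] at this
    exact dist_le_zero.1 this
  have hφU : MeasurableSet (φ '' U) := hU.image_of_measurable_injOn hφ hinj
  have hG : MeasurableSet (E ∩ U) := hE.inter hU
  -- the extension
  obtain ⟨F, hF, hFf⟩ : ∃ F : W → Linf, LipschitzWith (L * lam.toNNReal) F ∧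
      ∀ x ∈ E ∩ U, F (φ x) = f x := by
    rcases (E ∩ U).eq_empty_or_nonempty with he | ⟨x0, hx0⟩
    · exact ⟨fun _ => 0, (LipschitzWith.const 0).weaken bot_le, by simp [he]⟩
    have : Nonempty X := ⟨x0⟩
    have hinj' : InjOn φ (E ∩ U) := hinj.mono inter_subset_right
    have hl : LipschitzOnWith (L * lam.toNNReal) (f ∘ Function.invFunOn φ (E ∩ U)) (φ '' (E ∩ U)) := by
      refine LipschitzOnWith.of_dist_le_mul ?_
      rintro _ ⟨x, hx, rfl⟩ _ ⟨y, hy, rfl⟩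
      simp only [Function.comp]
      rw [hinj'.leftInvOn_invFunOn hx, hinj'.leftInvOn_invFunOn hy]
      refine (hf.dist_le_mul _ hx.1 _ hy.1).trans ?_
      push_cast
      rw [Real.coe_toNNReal _ hl0.le, mul_assoc]
      gcongr
      exact (hbi x hx.2 y hy.2).1
    obtain ⟨F, hF, hEq⟩ := hl.extend_lp_infty
    refine ⟨F, hF, fun x hx => ?_⟩
    rw [← hEq (mem_image_of_mem _ hx)]
    simp only [Function.comp]
    rw [hinj'.leftInvOn_invFunOn hx]
  set K : ℝ≥0 := L * lam.toNNReal with hK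
  have hac : Measure.map φ (m.restrict U) ≪ (volume : Measure W) :=
    (Measure.absolutelyContinuous_of_le hm2).trans
      ((Measure.smul_absolutelyContinuous).trans Measure.absolutelyContinuous_restrict)
  have A1 := density_ball hdoub hG
  have A2 := ae_ball_pos m
  have A3 := (ae_restrict_iff' hU).1 (ae_of_ae_map hφ.aemeasurable (hac.ae_le (ball_energy_tendsto hF)))
  have A4 := (ae_restrict_iff' hU).1 (ae_of_ae_map hφ.aemeasurable
    (hac.ae_le (density_ball (doubling_volume W) hφU)))
  filter_upwards [A1, A2, A3, A4] with x h1 h2 h3 h4 hxE hxU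
  have hx : x ∈ E ∩ U := ⟨hxE, hxU⟩
  obtain ⟨q, hq, hqt⟩ := h3 hxU
  have h4 := h4 hxU (mem_image_of_mem _ hxU)
  have h1 := h1 hx
  have hineq := fun r hr => chart_ineqs (r := r) hlam hU hφ hφU hbi hm1 hm2 hE hf hF hFf hx hr
  set d := Module.finrank ℝ W
  set ω : ℝ := (volume (ball (0:W) 1)).toReal with hωd
  have hω : 0 < ω := ENNReal.toReal_pos (measure_ball_pos _ _ one_pos).ne' measure_ball_lt_top.ne
  have hvb : ∀ r : ℝ, 0 < r → (volume (ball (φ x) r)).toReal = ω * r ^ d := by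
    intro r hr
    rw [Measure.addHaar_ball_of_pos _ _ hr, ENNReal.toReal_mul, ENNReal.toReal_ofReal (by positivity), mul_comm]
  have pos : ∀ᶠ r : ℝ in 𝓝[>] 0, 0 < r := self_mem_nhdsWithin
  have mb : ∀ r, m (ball x r) ≠ ∞ := fun r => (hfin _ isBounded_ball).ne
  have vbf : ∀ r, volume (ball (φ x) r) ≠ ∞ := fun r => measure_ball_lt_top.ne
  have Mf : ∀ r, m (ball x r \ (E ∩ U)) ≠ ∞ := fun r => measure_ne_top_of_subset sdiff_subset (mb r)
  have Wf : ∀ r, volume (ball (φ x) r \ φ '' U) ≠ ∞ := fun r => measure_ne_top_of_subset sdiff_subset (vbf r)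
  have Vf : ∀ r, volume (ball (φ x) r ∩ φ '' U) ≠ ∞ := fun r => measure_ne_top_of_subset inter_subset_left (vbf r)
  have Jf : ∀ r, ∫⁻ z in ball (φ x) r, ENNReal.ofReal (‖F z - F (φ x)‖ ^ 2) ≠ ∞ := by
    intro r
    have : ∫⁻ z in ball (φ x) r, ENNReal.ofReal (‖F z - F (φ x)‖ ^ 2) ≤
        ∫⁻ z in ball (φ x) r, ENNReal.ofReal ((K * r) ^ 2) := by
      refine setLIntegral_mono' measurableSet_ball fun z hz => ?_
      gcongr
      rw [← dist_eq_norm]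
      refine (hF.dist_le_mul _ _).trans ?_
      gcongr
      exact (mem_ball.1 hz).le
    refine ne_top_of_le_ne_top ?_ this
    rw [setLIntegral_const]
    exact ENNReal.mul_ne_top ENNReal.ofReal_ne_top (vbf r)
  have If : ∀ r, ∫⁻ y in ball x r ∩ E, ENNReal.ofReal (‖f x - f y‖ ^ 2) ∂m ≠ ∞ := by
    intro r
    have : ∫⁻ y in ball x r ∩ E, ENNReal.ofReal (‖f x - f y‖ ^ 2) ∂m ≤
        ∫⁻ z in ball x r ∩ E, ENNReal.ofReal ((L * r) ^ 2) ∂m := by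
      refine setLIntegral_mono' (measurableSet_ball.inter hE) fun z hz => ?_
      gcongr
      rw [← dist_eq_norm]
      refine (hf.dist_le_mul _ hxE _ hz.2).trans ?_
      gcongr
      exact (mem_ball'.1 hz.1).le
    refine ne_top_of_le_ne_top ?_ this
    rw [setLIntegral_const]
    exact ENNReal.mul_ne_top ENNReal.ofReal_ne_top (measure_ne_top_of_subset inter_subset_left (mb r))
  have hWt : Tendsto (fun r => (volume (ball (φ x) r \ φ '' U)).toReal / r ^ d) (𝓝[>] 0) (𝓝 0) := by
    have := ((ENNReal.tendsto_toReal ENNReal.zero_ne_top).comp h4).const_mul ω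
    simp only [ENNReal.toReal_zero, mul_zero] at this
    refine this.congr' ?_
    filter_upwards [pos] with r hr
    simp only [Function.comp, ENNReal.toReal_div]
    rw [hvb r hr]
    field_simp
  refine ⟨q.toReal / ω, sandwich_real d (c := c) (L := L ^ 2) (K := K ^ 2)
    (I := fun r => (∫⁻ y in ball x r ∩ E, ENNReal.ofReal (‖f x - f y‖ ^ 2) ∂m).toReal)
    (b := fun r => (m (ball x r)).toReal)
    (M := fun r => (m (ball x r \ (E ∩ U))).toReal)
    (V := fun r => (volume (ball (φ x) r ∩ φ '' U)).toReal)
    (W := fun r => (volume (ball (φ x) r \ φ '' U)).toReal)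
    (J := fun r => (∫⁻ z in ball (φ x) r, ENNReal.ofReal (‖F z - F (φ x)‖ ^ 2)).toReal)
    hlam (by exact_mod_cast hc) hω ?_ (fun _ => ENNReal.toReal_nonneg) (fun _ => ENNReal.toReal_nonneg)
    (fun _ => ENNReal.toReal_nonneg) ?_ ?_ ?_ ?_ (by positivity) ?_ ?_ hWt ?_⟩
  · filter_upwards [pos] with r hr
    exact ENNReal.toReal_pos (h2 r hr).ne' (mb r)
  · filter_upwards [pos] with r hr
    have := ENNReal.toReal_mono (by finiteness [Jf (lam * r), Mf r]) (hineq r hr).1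
    rw [ENNReal.toReal_add (by finiteness [Jf (lam * r), Mf r]) (by finiteness [Jf (lam * r), Mf r])] at this
    simp only [ENNReal.toReal_mul, ENNReal.coe_toReal, ENNReal.toReal_ofReal hl0.le,
      ENNReal.toReal_ofReal (show (0:ℝ) ≤ L ^ 2 * r ^ 2 by positivity)] at this
    exact this
  · filter_upwards [pos] with r hr
    have := ENNReal.toReal_mono (mb r) (hineq r hr).2.1
    simpa [ENNReal.toReal_mul] using this
  · filter_upwards [pos] with r hr
    have := ENNReal.toReal_mono (by finiteness [If r, Mf r, Wf (r / lam)]) (hineq r hr).2.2.1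
    rw [ENNReal.toReal_add (by finiteness [If r, Mf r, Wf (r / lam)]) (by finiteness [If r, Mf r, Wf (r / lam)]),
      ENNReal.toReal_add (by finiteness [If r, Mf r, Wf (r / lam)]) (by finiteness [If r, Mf r, Wf (r / lam)])] at this
    simp only [ENNReal.toReal_mul, ENNReal.coe_toReal, ENNReal.toReal_ofReal (show (0:ℝ) ≤ K ^ 2 * r ^ 2 by positivity)] at this
    linarith
  · filter_upwards [pos] with r hr
    have := ENNReal.toReal_mono (by finiteness [vbf (lam * r), Mf r]) (hineq r hr).2.2.2
    rw [ENNReal.toReal_add (by finiteness [vbf (lam * r), Mf r]) (by finiteness [vbf (lam * r), Mf r])] at this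
    simp only [ENNReal.toReal_mul, ENNReal.coe_toReal, ENNReal.toReal_ofReal hl0.le, hvb _ (mul_pos hl0 hr)] at this
    linarith
  · have := ((ENNReal.tendsto_toReal ENNReal.zero_ne_top).comp h1)
    refine this.congr fun r => ?_
    simp [ENNReal.toReal_div]
  · have := hWt.const_sub ω
    rw [sub_zero] at this
    refine this.congr' ?_
    filter_upwards [pos] with r hr
    have e : (volume (ball (φ x) r ∩ φ '' U)).toReal + (volume (ball (φ x) r \ φ '' U)).toReal = ω * r ^ d := by
      rw [← hvb r hr, ← ENNReal.toReal_add (Vf r) (Wf r), measure_inter_add_sdiff _ hφU]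
    rw [eq_div_iff (by positivity), sub_mul, div_mul_cancel₀ _ (by positivity)]
    linarith
  · have := ((ENNReal.tendsto_toReal hq).comp hqt)
    refine this.congr' ?_
    filter_upwards [pos] with r hr
    simp [ENNReal.toReal_div, ENNReal.toReal_ofReal (show (0:ℝ) ≤ r ^ (d + 2) by positivity)]


lemma tendsto_of_sandwiches {P : ℝ → ℝ} {B : ℝ} (hB : ∀ᶠ r in 𝓝[>] (0:ℝ), 0 ≤ P r ∧ P r ≤ B) (p : ℕ)
    (h : ∀ n : ℕ, ∃ Q : ℝ, ∃ Up Lw : ℝ → ℝ,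
      Tendsto Up (𝓝[>] 0) (𝓝 ((1 + 1 / ((n:ℝ) + 1)) ^ p * Q)) ∧
      Tendsto Lw (𝓝[>] 0) (𝓝 (((1 + 1 / ((n:ℝ) + 1)) ^ p)⁻¹ * Q)) ∧
      (∀ᶠ r in 𝓝[>] (0:ℝ), P r ≤ Up r) ∧ (∀ᶠ r in 𝓝[>] (0:ℝ), Lw r ≤ P r)) :
    ∃ l : ℝ, Tendsto P (𝓝[>] 0) (𝓝 l) := by
  have b1 : IsBoundedUnder (· ≤ ·) (𝓝[>] (0:ℝ)) P := ⟨B, by simpa using hB.mono fun r h => h.2⟩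
  have b2 : IsBoundedUnder (· ≥ ·) (𝓝[>] (0:ℝ)) P := ⟨0, by simpa using hB.mono fun r h => h.1⟩
  have key : ∀ n : ℕ, limsup P (𝓝[>] 0) ≤ ((1 + 1 / ((n:ℝ) + 1)) ^ p) ^ 2 * liminf P (𝓝[>] 0) := by
    intro n
    obtain ⟨Q, Up, Lw, h1, h2, h3, h4⟩ := h n
    set a := (1 + 1 / ((n:ℝ) + 1)) ^ p with ha
    have hapos : 0 < a := by positivity
    have e1 : limsup P (𝓝[>] 0) ≤ a * Q := by
      rw [← h1.limsup_eq]
      exact limsup_le_limsup h3 b2.isCoboundedUnder_flip h1.isBoundedUnder_le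
    have e2 : a⁻¹ * Q ≤ liminf P (𝓝[>] 0) := by
      rw [← h2.liminf_eq]
      exact liminf_le_liminf h4 h2.isBoundedUnder_ge b1.isCoboundedUnder_flip
    calc _ ≤ a * Q := e1
      _ = a ^ 2 * (a⁻¹ * Q) := by field_simp
      _ ≤ _ := by gcongr
  have lim : Tendsto (fun n : ℕ => ((1 + 1 / ((n:ℝ) + 1)) ^ p) ^ 2 * liminf P (𝓝[>] 0)) atTop
      (𝓝 (((1 + 0) ^ p) ^ 2 * liminf P (𝓝[>] 0))) :=
    (((tendsto_one_div_add_atTop_nhds_zero_nat.const_add 1).pow p).pow 2).mul_const _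
  have := ge_of_tendsto' lim key
  simp only [add_zero, one_pow, one_mul] at this
  exact ⟨liminf P (𝓝[>] 0), tendsto_of_le_liminf_of_limsup_le le_rfl this b1 b2⟩

lemma P_tendsto [MetricSpace X] [CompleteSpace X] [TopologicalSpace.SeparableSpace X]
    [MeasurableSpace X] [BorelSpace X] {m : Measure X}
    (hfin : FiniteOnBounded m) (hdoub : LocUnifDoubling m) {d : ℕ} (hrect : StronglyRectifiable m d)
    {E : Set X}
    (hE : MeasurableSet E) {f : X → Linf} {L : ℝ≥0} (hf : LipschitzOnWith L f E) :
    ∀ᵐ x ∂m, x ∈ E → ∃ l : ℝ≥0∞, l ≠ ∞ ∧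
      Tendsto (fun r => (∫⁻ y in ball x r ∩ E, ENNReal.ofReal (‖f x - f y‖ ^ 2) ∂m) /
        (m (ball x r) * ENNReal.ofReal (r ^ 2))) (𝓝[>] 0) (𝓝 l) := by
  have : SecondCountableTopology X := UniformSpace.secondCountable_of_separable X
  have main : ∀ n : ℕ, ∀ᵐ x ∂m, x ∈ E → ∃ Q : ℝ, ∃ Up Lw : ℝ → ℝ,
      Tendsto Up (𝓝[>] 0) (𝓝 ((1 + 1 / ((n:ℝ) + 1)) ^ (2 * d + 3) * Q)) ∧
      Tendsto Lw (𝓝[>] 0) (𝓝 (((1 + 1 / ((n:ℝ) + 1)) ^ (2 * d + 3))⁻¹ * Q)) ∧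
      (∀ᶠ r in 𝓝[>] (0:ℝ), (∫⁻ y in ball x r ∩ E, ENNReal.ofReal (‖f x - f y‖ ^ 2) ∂m).toReal /
        ((m (ball x r)).toReal * r ^ 2) ≤ Up r) ∧
      (∀ᶠ r in 𝓝[>] (0:ℝ), Lw r ≤ (∫⁻ y in ball x r ∩ E, ENNReal.ofReal (‖f x - f y‖ ^ 2) ∂m).toReal /
        ((m (ball x r)).toReal * r ^ 2)) := by
    intro n
    have hε : (0:ℝ) < 1 / ((n:ℝ) + 1) := by positivity
    obtain ⟨U, φ, c, hU, -, hcov, hch⟩ := hrect _ hε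
    have hcov' : ∀ᵐ x ∂m, x ∈ ⋃ i, U i := by
      rw [ae_iff]
      refine measure_mono_null ?_ hcov
      intro x hx
      exact ⟨mem_univ _, hx⟩
    have h1 := fun i => chart_sandwich hfin hdoub (lam := 1 + 1 / ((n:ℝ) + 1)) (by linarith) (hch i).1 (hU i)
      (hch i).2.1 (hch i).2.2.1 (hch i).2.2.2.1 (hch i).2.2.2.2 hE hf
    simp only [finrank_euclideanSpace, Fintype.card_fin] at h1
    filter_upwards [ae_all_iff.2 h1, hcov'] with x hx hxU hxE
    obtain ⟨i, hi⟩ := mem_iUnion.1 hxU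
    exact hx i hxE hi
  filter_upwards [ae_all_iff.2 main, ae_ball_pos m] with x hx hpos hxE
  have mb : ∀ r, m (ball x r) ≠ ∞ := fun r => (hfin _ isBounded_ball).ne
  have Ib : ∀ r, 0 < r → ∫⁻ y in ball x r ∩ E, ENNReal.ofReal (‖f x - f y‖ ^ 2) ∂m ≤
      ENNReal.ofReal (L ^ 2 * r ^ 2) * m (ball x r) := by
    intro r hr
    calc ∫⁻ y in ball x r ∩ E, ENNReal.ofReal (‖f x - f y‖ ^ 2) ∂m ≤
        ∫⁻ z in ball x r ∩ E, ENNReal.ofReal (L ^ 2 * r ^ 2) ∂m := by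
          refine setLIntegral_mono' (measurableSet_ball.inter hE) fun z hz => ?_
          rw [← mul_pow]
          gcongr
          rw [← dist_eq_norm]
          refine (hf.dist_le_mul _ hxE _ hz.2).trans ?_
          gcongr
          exact (mem_ball'.1 hz.1).le
      _ = _ := setLIntegral_const _ _
      _ ≤ _ := by gcongr; exact inter_subset_left
  have If : ∀ r, 0 < r → ∫⁻ y in ball x r ∩ E, ENNReal.ofReal (‖f x - f y‖ ^ 2) ∂m ≠ ∞ := fun r hr =>
    ne_top_of_le_ne_top (by finiteness [mb r]) (Ib r hr)
  have hB : ∀ᶠ r in 𝓝[>] (0:ℝ), 0 ≤ (∫⁻ y in ball x r ∩ E, ENNReal.ofReal (‖f x - f y‖ ^ 2) ∂m).toReal /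
        ((m (ball x r)).toReal * r ^ 2) ∧ (∫⁻ y in ball x r ∩ E, ENNReal.ofReal (‖f x - f y‖ ^ 2) ∂m).toReal /
        ((m (ball x r)).toReal * r ^ 2) ≤ L ^ 2 := by
    filter_upwards [self_mem_nhdsWithin] with r (hr : 0 < r)
    have hb := ENNReal.toReal_pos (hpos r hr).ne' (mb r)
    refine ⟨by positivity, ?_⟩
    rw [div_le_iff₀ (by positivity)]
    have := ENNReal.toReal_mono (by finiteness [mb r]) (Ib r hr)
    rw [ENNReal.toReal_mul, ENNReal.toReal_ofReal (by positivity)] at this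
    linarith
  obtain ⟨l, hl⟩ := tendsto_of_sandwiches hB _ (fun n => hx n hxE)
  refine ⟨ENNReal.ofReal l, ENNReal.ofReal_ne_top, ?_⟩
  refine (ENNReal.tendsto_ofReal hl).congr' ?_
  filter_upwards [self_mem_nhdsWithin] with r (hr : 0 < r)
  have hb := ENNReal.toReal_pos (hpos r hr).ne' (mb r)
  rw [ENNReal.ofReal_div_of_pos (by positivity), ENNReal.ofReal_toReal (If r hr),
    ENNReal.ofReal_mul (by positivity), ENNReal.ofReal_toReal (mb r)]


/-- the normalized ball average of a kernel -/
def av [MetricSpace X] [MeasurableSpace X] (m : Measure X) (D : X → X → ℝ≥0∞) (r : ℝ) (x : X) : ℝ≥0∞ :=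
  (∫⁻ y in ball x r, D x y ∂m) / (m (ball x r) * ENNReal.ofReal (r ^ 2))

lemma inv_le_of_le {a b : ℝ≥0∞} {C : ℝ≥0} (hC : 0 < C) (h : a ≤ C * b) : b⁻¹ ≤ C * a⁻¹ := by
  have hC' : (C : ℝ≥0∞) ≠ 0 := by exact_mod_cast hC.ne'
  calc b⁻¹ = C * (C * b)⁻¹ := by
        rw [ENNReal.mul_inv (Or.inl hC') (Or.inl ENNReal.coe_ne_top), ← mul_assoc,
          ENNReal.mul_inv_cancel hC' ENNReal.coe_ne_top, one_mul]
    _ ≤ _ := by gcongr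

section avm
variable [MetricSpace X] [SecondCountableTopology X] [MeasurableSpace X] [BorelSpace X] {m : Measure X}

lemma measurable_ball_lint [SFinite m] {D : X → X → ℝ≥0∞} (hD : Measurable (Function.uncurry D)) (r : ℝ) :
    Measurable (fun x => ∫⁻ y in ball x r, D x y ∂m) := by
  have hS : MeasurableSet {p : X × X | dist p.2 p.1 < r} :=
    (isOpen_lt (by fun_prop) continuous_const).measurableSet
  have h := (hD.indicator hS).lintegral_prod_right' (ν := m)
  have e : (fun x => ∫⁻ y in ball x r, D x y ∂m) = fun x =>
      ∫⁻ y, {p : X × X | dist p.2 p.1 < r}.indicator (Function.uncurry D) (x, y) ∂m := by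
    funext x
    rw [← lintegral_indicator measurableSet_ball]
    rfl
  rw [e]
  exact h

lemma measurable_measure_ball [SFinite m] (r : ℝ) : Measurable (fun x => m (ball x r)) := by
  have := measurable_ball_lint (m := m) (D := fun _ _ => 1) measurable_const r
  simpa using this

lemma measurable_av [SFinite m] {D : X → X → ℝ≥0∞} (hD : Measurable (Function.uncurry D)) (r : ℝ) :
    Measurable (av m D r) :=
  (measurable_ball_lint hD r).div ((measurable_measure_ball r).mul_const _)

lemma av_add {D D' : X → X → ℝ≥0∞} (hD : Measurable (Function.uncurry D)) (r : ℝ) (x : X) :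
    av m (fun x y => D x y + D' x y) r x = av m D r x + av m D' r x := by
  have h : Measurable (D x) := hD.comp measurable_prodMk_left
  simp only [av]
  rw [lintegral_add_left h, ENNReal.add_div]

/-- Tonelli estimate -/
lemma tonelli_av [SFinite m] {D : X → X → ℝ≥0∞} (hD : Measurable (Function.uncurry D))
    (hsym : ∀ x y, D x y = D y x) {C : ℝ≥0} (hC : 0 < C) {r : ℝ}
    (hdb : ∀ x : X, m (ball x (2 * r)) ≤ C * m (ball x r))
    {K E : Set X} (hK : MeasurableSet K) (hE : MeasurableSet E) :
    ∫⁻ x in K, av m (fun x y => Eᶜ.indicator (D x) y) r x ∂m ≤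
      C * ∫⁻ y in thickening r K \ E, av m D r y ∂m := by
  set κ : X → X → ℝ≥0∞ := fun x y =>
    (K ×ˢ Eᶜ ∩ {p : X × X | dist p.2 p.1 < r}).indicator
      (fun p => D p.1 p.2 / (m (ball p.1 r) * ENNReal.ofReal (r ^ 2))) (x, y) with hκ
  have hS : MeasurableSet {p : X × X | dist p.2 p.1 < r} :=
    (isOpen_lt (by fun_prop) continuous_const).measurableSet
  have hκm : Measurable (Function.uncurry κ) := by
    refine Measurable.indicator ?_ ((hK.prod hE.compl).inter hS)
    refine Measurable.div hD (Measurable.mul_const ?_ _)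
    exact (measurable_measure_ball r).comp measurable_fst
  have e1 : ∫⁻ x in K, av m (fun x y => Eᶜ.indicator (D x) y) r x ∂m = ∫⁻ x, ∫⁻ y, κ x y ∂m ∂m := by
    rw [← lintegral_indicator hK]
    refine lintegral_congr fun x => ?_
    by_cases hx : x ∈ K
    · rw [indicator_of_mem hx]
      unfold av
      rw [div_eq_mul_inv, ← lintegral_mul_const'' _ (by
        exact ((hD.comp measurable_prodMk_left).indicator hE.compl).aemeasurable),
        ← lintegral_indicator measurableSet_ball]
      refine lintegral_congr fun y => ?_
      simp only [hκ, indicator, mem_inter_iff, mem_prod, mem_compl_iff, mem_ofPred_eq, mem_ball, hx, true_and]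
      by_cases h1 : dist y x < r <;> by_cases h2 : y ∈ E <;> simp [h1, h2, div_eq_mul_inv]
    · rw [indicator_of_notMem hx]
      symm
      rw [lintegral_eq_zero_iff' (by exact (hκm.comp measurable_prodMk_left).aemeasurable)]
      refine Eventually.of_forall fun y => ?_
      simp [hκ, hx]
  rw [e1, lintegral_lintegral_swap hκm.aemeasurable, ← lintegral_const_mul' _ _ ENNReal.coe_ne_top,
    ← lintegral_indicator (isOpen_thickening.measurableSet.diff hE)]
  refine lintegral_mono fun y => ?_
  by_cases hy : y ∈ thickening r K \ E
  · rw [indicator_of_mem hy]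
    unfold av
    rw [div_eq_mul_inv, ← lintegral_mul_const'' _ (by
        exact (hD.comp measurable_prodMk_left).aemeasurable), ← lintegral_const_mul' _ _ ENNReal.coe_ne_top,
      ← lintegral_indicator measurableSet_ball]
    refine lintegral_mono fun x => ?_
    by_cases hxy : dist y x < r
    · have hx' : x ∈ ball y r := by rwa [mem_ball']
      rw [indicator_of_mem hx']
      have hle : κ x y ≤ D x y / (m (ball x r) * ENNReal.ofReal (r ^ 2)) := by
        simp only [hκ]
        exact indicator_le_self' (fun _ _ => bot_le) (x, y)
      refine hle.trans ?_
      rw [hsym x y, div_eq_mul_inv, mul_left_comm]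
      gcongr
      refine inv_le_of_le hC ?_
      rw [← mul_assoc]
      gcongr
      refine (measure_mono ?_).trans (hdb x)
      refine ball_subset_ball' ?_
      linarith
    · have : κ x y = 0 := by simp [hκ, hxy]
      rw [this]
      exact bot_le
  · rw [indicator_of_notMem hy]
    refine le_of_eq ?_
    rw [lintegral_eq_zero_iff' (by exact (hκm.comp measurable_prodMk_right).aemeasurable)]
    refine Eventually.of_forall fun x => ?_
    simp only [hκ, Pi.zero_apply]
    refine indicator_of_notMem ?_ _
    rintro ⟨⟨h1, h2⟩, h3⟩
    exact hy ⟨mem_thickening_iff.2 ⟨x, h1, h3⟩, h2⟩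

/-- real averages versus extended ones -/
lemma real_avg {g : X → ℝ} (hg : Measurable g) (h0 : ∀ y, 0 ≤ g y) {S T : Set X}
    (hS : MeasurableSet S) {r : ℝ} (hr : 0 < r) :
    (m T).toReal⁻¹ * ∫ y in T \ S, g y / r ^ 2 ∂m =
      ((∫⁻ y in T, Sᶜ.indicator (fun y => ENNReal.ofReal (g y)) y ∂m) /
        (m T * ENNReal.ofReal (r ^ 2))).toReal := by
  rw [integral_div, integral_eq_lintegral_of_nonneg_ae (Eventually.of_forall h0) hg.aestronglyMeasurable,
    lintegral_indicator hS.compl, Measure.restrict_restrict hS.compl, inter_comm, ← sdiff_eq,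
    ENNReal.toReal_div, ENNReal.toReal_mul, ENNReal.toReal_ofReal (by positivity)]
  field_simp
end avm


section far
variable [MetricSpace X] [SecondCountableTopology X] [MeasurableSpace X] [BorelSpace X] {m : Measure X}

lemma isClosed_ball_subset (Ω : Set X) (r : ℝ) : IsClosed {x : X | ball x r ⊆ Ω} := by
  have : {x : X | ball x r ⊆ Ω} = (thickening r Ωᶜ)ᶜ := by
    ext x
    rw [mem_compl_iff, mem_thickening_iff]
    constructor
    · rintro h ⟨z, hz, hxz⟩
      exact hz (h (mem_ball'.2 hxz))
    · intro h y hy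
      by_contra hcon
      exact h ⟨y, hcon, mem_ball'.1 hy⟩
  rw [this]
  exact isOpen_thickening.isClosed_compl

lemma far_small (hfin : FiniteOnBounded m) (hdoub : LocUnifDoubling m) {Ω E : Set X}
    (hΩ : IsOpen Ω) (hE : MeasurableSet E) (hEΩ : E ⊆ Ω)
    {D : X → X → ℝ≥0∞} (hD : Measurable (Function.uncurry D))
    (hsym : ∀ x y, D x y = D y x) {e2 : X → ℝ≥0∞}
    (he : ∫⁻ x in Ω, e2 x ∂m ≠ ∞) {η : ℝ → ℝ≥0∞} (hη : Tendsto η (𝓝[>] 0) (𝓝 0))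
    (hS : ∀ᶠ r in 𝓝[>] (0:ℝ), ∀ S : Set X, MeasurableSet S → S ⊆ Ω → (∀ x ∈ S, ball x r ⊆ Ω) →
      ∫⁻ x in S, av m D r x ∂m ≤ 2 * ∫⁻ x in S, e2 x ∂m + η r)
    (hconv : ∀ᵐ x ∂m, x ∈ E → ∃ l, Tendsto (fun r => av m (fun x y => Eᶜ.indicator (D x) y) r x)
      (𝓝[>] 0) (𝓝 l)) :
    ∀ᵐ x ∂m, x ∈ E → Tendsto (fun r => av m (fun x y => Eᶜ.indicator (D x) y) r x)
      (𝓝[>] 0) (𝓝 0) := by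
  have : IsLocallyFiniteMeasure m := locFin_of_bdd hfin
  set h : ℝ → X → ℝ≥0∞ := av m (fun x y => Eᶜ.indicator (D x) y) with hh
  have hm : ∀ r, Measurable (h r) := by
    intro r
    refine measurable_av ?_ r
    have : Function.uncurry (fun x y => Eᶜ.indicator (D x) y) =
        (univ ×ˢ Eᶜ).indicator (Function.uncurry D) := by
      funext ⟨x, y⟩
      simp [indicator, Function.uncurry]
    rw [this]
    exact hD.indicator (MeasurableSet.univ.prod hE.compl)
  obtain ⟨C, hC, hdb⟩ := hdoub 1 one_pos
  set μ : Measure X := (m.restrict Ω).withDensity e2 with hμ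
  have hμf : IsFiniteMeasure μ := isFiniteMeasure_withDensity he
  -- closed pieces
  have closed_case : ∀ (F : Set X) (δ : ℝ), 0 < δ → IsClosed F → F ⊆ E → (∀ x ∈ F, ball x δ ⊆ Ω) →
      ∀ᵐ x ∂m, x ∈ F → Tendsto (fun r => h r x) (𝓝[>] 0) (𝓝 0) := by
    intro F δ hδ hF hFE hFδ
    have hlim : Tendsto (fun r => ∫⁻ x in F, h r x ∂m) (𝓝[>] 0) (𝓝 0) := by
      have t1 : Tendsto (fun r => μ (thickening r F)) (𝓝[>] 0) (𝓝 (μ F)) :=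
        tendsto_measure_thickening_of_isClosed ⟨1, one_pos, measure_ne_top _ _⟩ hF
      have t2 : Tendsto (fun r => (C : ℝ≥0∞) * (2 * (μ (thickening r F) - μ F) + η r)) (𝓝[>] 0) (𝓝 0) := by
        have := ENNReal.Tendsto.const_mul (a := (C : ℝ≥0∞)) (((ENNReal.Tendsto.const_mul (a := 2)
          (ENNReal.Tendsto.sub t1 (tendsto_const_nhds (x := μ F)) (Or.inl (measure_ne_top μ F)))
          (Or.inr (by simp)))).add hη) (Or.inr ENNReal.coe_ne_top)
        simpa using this
      refine tendsto_of_tendsto_of_tendsto_of_le_of_le' tendsto_const_nhds t2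
        (Eventually.of_forall fun _ => bot_le) ?_
      have hsmall : ∀ᶠ r : ℝ in 𝓝[>] 0, 0 < r ∧ r < min 1 (δ / 2) := Ioo_mem_nhdsGT (by positivity)
      filter_upwards [hsmall, hS] with r ⟨hr0, hr1⟩ hSr
      have hr2 : r < 1 := hr1.trans_le (min_le_left _ _)
      have hr3 : r < δ / 2 := hr1.trans_le (min_le_right _ _)
      refine (tonelli_av hD hsym hC (fun x => hdb x r hr0 hr2) hF.measurableSet hE).trans ?_
      gcongr
      have hthm : MeasurableSet (thickening r F \ E) := isOpen_thickening.measurableSet.diff hE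
      have hsub : ∀ x ∈ thickening r F \ E, ball x r ⊆ Ω := by
        rintro x ⟨hx, -⟩
        obtain ⟨z, hz, hxz⟩ := mem_thickening_iff.1 hx
        refine (ball_subset_ball' ?_).trans (hFδ z hz)
        linarith
      have hsubΩ : thickening r F \ E ⊆ Ω := fun x hx => hsub x hx (mem_ball_self hr0)
      refine (hSr _ hthm hsubΩ hsub).trans ?_
      gcongr
      rw [← measure_sdiff (self_subset_thickening hr0 F) hF.measurableSet.nullMeasurableSet (measure_ne_top _ _),
        hμ, withDensity_apply _ (isOpen_thickening.measurableSet.diff hF.measurableSet),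
        Measure.restrict_restrict (isOpen_thickening.measurableSet.diff hF.measurableSet)]
      refine lintegral_mono_set ?_
      intro x hx
      exact ⟨⟨hx.1, fun hxF => hx.2 (hFE hxF)⟩, hsubΩ hx⟩
    -- Fatou
    have hseq : Tendsto (fun n : ℕ => 1 / ((n:ℝ) + 1)) atTop (𝓝[>] 0) :=
      tendsto_nhdsWithin_iff.2 ⟨tendsto_one_div_add_atTop_nhds_zero_nat,
        Eventually.of_forall fun n => by simp only [mem_Ioi]; positivity⟩
    have hfatou : ∫⁻ x in F, liminf (fun n : ℕ => h (1 / ((n:ℝ) + 1)) x) atTop ∂m = 0 := by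
      have := lintegral_liminf_le (μ := m.restrict F) (u := atTop) (f := fun n : ℕ => h (1 / ((n:ℝ) + 1))) (fun n => hm _)
      have h0 := (hlim.comp hseq).liminf_eq
      exact le_antisymm (this.trans_eq h0) bot_le
    rw [lintegral_eq_zero_iff (.liminf fun n => hm _)] at hfatou
    have h2 := (ae_restrict_iff' hF.measurableSet).1 hfatou
    filter_upwards [h2, hconv] with x hx hc hxF
    obtain ⟨l, hl⟩ := hc (hFE hxF)
    have : l = 0 := by
      rw [← (hl.comp hseq).liminf_eq]
      exact hx hxF
    rwa [this] at hl
  -- covering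
  rcases isEmpty_or_nonempty X with hX | ⟨⟨x0⟩⟩
  · exact Eventually.of_forall fun x => (hX.false x).elim
  set N : Set X := {x | ¬ Tendsto (fun r => h r x) (𝓝[>] 0) (𝓝 0)} with hN
  have hpiece : ∀ n : ℕ, m (N ∩ (E ∩ {x | ball x (1 / ((n:ℝ) + 1)) ⊆ Ω} ∩ ball x0 n)) = 0 := by
    intro n
    set En := E ∩ {x | ball x (1 / ((n:ℝ) + 1)) ⊆ Ω} ∩ ball x0 n with hEn
    have hEnm : MeasurableSet En := (hE.inter (isClosed_ball_subset Ω _).measurableSet).inter measurableSet_ball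
    have hEnf : m En ≠ ∞ := (hfin _ (isBounded_ball.subset inter_subset_right)).ne
    refine le_antisymm (ENNReal.le_of_forall_pos_le_add fun ε hε _ => ?_) bot_le
    obtain ⟨F, hFE, hFc, hFlt⟩ := hEnm.exists_isClosed_sdiff_lt hEnf (ε := ε) (by exact_mod_cast hε.ne')
    have h0 : m (N ∩ F) = 0 := by
      have := closed_case F (1 / ((n:ℝ) + 1)) (by positivity) hFc (fun x hx => (hFE hx).1.1)
        (fun x hx => (hFE hx).1.2)
      rw [ae_iff] at this
      refine measure_mono_null ?_ this
      rintro x ⟨h1, h2⟩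
      simp only [Classical.not_imp, mem_ofPred_eq]
      exact ⟨h2, h1⟩
    calc m (N ∩ En) ≤ m ((N ∩ F) ∪ (En \ F)) := by
          refine measure_mono ?_
          rintro x ⟨h1, h2⟩
          by_cases hx : x ∈ F
          · exact Or.inl ⟨h1, hx⟩
          · exact Or.inr ⟨h2, hx⟩
      _ ≤ m (N ∩ F) + m (En \ F) := measure_union_le _ _
      _ ≤ 0 + ε := by rw [h0]; gcongr
  rw [ae_iff]
  refine measure_mono_null ?_ (measure_iUnion_null hpiece)
  intro x hx
  simp only [Classical.not_imp, mem_ofPred_eq] at hx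
  obtain ⟨δ, hδ, hball⟩ := Metric.isOpen_iff.1 hΩ x (hEΩ hx.1)
  obtain ⟨n1, hn1⟩ := exists_nat_one_div_lt hδ
  obtain ⟨n2, hn2⟩ := exists_nat_gt (dist x x0)
  refine mem_iUnion.2 ⟨max n1 n2, hx.2, ⟨hx.1, ?_⟩, ?_⟩
  · refine (ball_subset_ball ?_).trans hball
    refine le_trans ?_ hn1.le
    gcongr
    exact le_max_left _ _
  · rw [mem_ball]
    refine hn2.trans_le ?_
    exact_mod_cast le_max_right _ _
end far


section lusin
variable [MetricSpace X] [SecondCountableTopology X] [MeasurableSpace X] [BorelSpace X] {m : Measure X}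
  [MetricSpace Y]

/-- the squared distance kernel -/
def dk (u : X → Y) (x y : X) : ℝ≥0∞ := ENNReal.ofReal (dist (u x) (u y) ^ 2)

lemma dk_tri (u : X → Y) (x y z : X) : dk u x y ≤ 2 * (dk u x z + dk u y z) := by
  unfold dk
  rw [← ENNReal.ofReal_add (by positivity) (by positivity), ← ENNReal.ofReal_ofNat 2,
    ← ENNReal.ofReal_mul (by norm_num)]
  apply ENNReal.ofReal_le_ofReal
  have h1 := dist_triangle_right (u x) (u y) (u z)
  have h2 : 0 ≤ dist (u x) (u y) := dist_nonneg
  nlinarith [sq_nonneg (dist (u x) (u z) - dist (u y) (u z))]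

lemma two_point (hfin : FiniteOnBounded m) {u : X → Y} (hD : Measurable (Function.uncurry (dk u)))
    {C : ℝ≥0} (hC : ∀ (x : X) (r : ℝ), 0 < r → r < 2 → m (ball x (2 * r)) ≤ (C : ℝ≥0∞) * m (ball x r))
    {x y : X} {s : ℝ} (hs : 0 < s) (hs2 : s < 2) (hxy : dist x y ≤ s / 2) (hpos : 0 < m (ball x (s / 2)))
    {L : ℝ≥0} (hx : av m (dk u) s x ≤ L) (hy : av m (dk u) s y ≤ L) :
    dist (u x) (u y) ^ 2 ≤ 2 * (L * (C + C ^ 2)) * s ^ 2 := by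
  have hf : ∀ z r, m (ball z r) ≠ ∞ := fun z r => (hfin _ isBounded_ball).ne
  set T := ball x (s / 2) with hT
  have hs20 : ENNReal.ofReal (s ^ 2) ≠ 0 := by simp; positivity
  have hTx : T ⊆ ball x s := ball_subset_ball (by linarith)
  have hTy : T ⊆ ball y s := ball_subset_ball' (by linarith)
  have hxs : m (ball x s) ≤ C * m T := by
    have := hC x (s / 2) (by linarith) (by linarith)
    rwa [mul_div_cancel₀ _ (two_ne_zero)] at this
  have hys : m (ball y s) ≤ C * (C * m T) := by
    calc m (ball y s) ≤ m (ball x (2 * s)) := measure_mono (ball_subset_ball' (by rw [dist_comm]; linarith))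
      _ ≤ C * m (ball x s) := hC x s hs hs2
      _ ≤ _ := by gcongr
  have key : ∀ z, T ⊆ ball z s → av m (dk u) s z ≤ L →
      ∫⁻ a in T, dk u z a ∂m ≤ L * (m (ball z s) * ENNReal.ofReal (s ^ 2)) := by
    intro z hTz hz
    have hz0 : m (ball z s) ≠ 0 := (hpos.trans_le (measure_mono hTz)).ne'
    unfold av at hz
    rw [ENNReal.div_le_iff (mul_ne_zero hz0 hs20) (ENNReal.mul_ne_top (hf _ _) ENNReal.ofReal_ne_top)] at hz
    exact (lintegral_mono_set hTz).trans hz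
  have hDx : ∀ z, Measurable (dk u z) := fun z => hD.comp measurable_prodMk_left
  have hint : ∫⁻ a in T, (dk u x a + dk u y a) ∂m ≤ (L * (C + C ^ 2)) * ENNReal.ofReal (s ^ 2) * m T := by
    rw [lintegral_add_left (hDx x)]
    calc _ ≤ L * (m (ball x s) * ENNReal.ofReal (s ^ 2)) + L * (m (ball y s) * ENNReal.ofReal (s ^ 2)) :=
          add_le_add (key x hTx hx) (key y hTy hy)
      _ ≤ L * (C * m T * ENNReal.ofReal (s ^ 2)) + L * (C * (C * m T) * ENNReal.ofReal (s ^ 2)) := by gcongr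
      _ = _ := by ring
  obtain ⟨z, hz, hzle⟩ := exists_le_setLAverage (μ := m) (s := T) hpos.ne' (hf _ _)
    (f := fun a => dk u x a + dk u y a) ((hDx x).add (hDx y)).aemeasurable
  rw [setLAverage_eq] at hzle
  have h3 := hzle.trans (ENNReal.div_le_of_le_mul hint)
  have h4 : dk u x y ≤ 2 * ((L * (C + C ^ 2)) * ENNReal.ofReal (s ^ 2)) :=
    (dk_tri u x y z).trans (by gcongr)
  have h5 : (2 : ℝ≥0∞) * ((L * (C + C ^ 2)) * ENNReal.ofReal (s ^ 2)) =
      ENNReal.ofReal (2 * (L * (C + C ^ 2)) * s ^ 2) := by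
    rw [ENNReal.ofReal_mul (by positivity), ENNReal.ofReal_mul (by positivity), ENNReal.ofReal_mul (by positivity),
      ENNReal.ofReal_add (by positivity) (by positivity), ENNReal.ofReal_pow (by positivity)]
    simp
    ring
  rw [h5] at h4
  exact (ENNReal.ofReal_le_ofReal_iff (by positivity)).1 h4

lemma lusin_lip (hfin : FiniteOnBounded m) (hdoub : LocUnifDoubling m) {Ω : Set X} (hΩ : MeasurableSet Ω)
    {u : X → Y} (hD : Measurable (Function.uncurry (dk u)))
    (hb : ∀ᵐ x ∂m, x ∈ Ω → ∃ B : ℝ≥0∞, B ≠ ∞ ∧ ∀ᶠ r in 𝓝[>] (0:ℝ), av m (dk u) r x ≤ B) :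
    ∃ E : ℕ → Set X, (∀ i, MeasurableSet (E i) ∧ E i ⊆ Ω ∧ ∃ L, LipschitzOnWith L u (E i)) ∧
      ∀ᵐ x ∂m, x ∈ Ω → ∃ i, x ∈ E i := by
  have : IsLocallyFiniteMeasure m := locFin_of_bdd hfin
  rcases isEmpty_or_nonempty X with hX | hX
  · exact ⟨fun _ => ∅, fun i => ⟨MeasurableSet.empty, empty_subset _, 0, by simp⟩,
      Eventually.of_forall fun x => (hX.false x).elim⟩
  obtain ⟨C, hC0, hC⟩ := hdoub 2 two_pos
  set K : ℕ → ℕ → Set X := fun L n => Ω ∩ {x | (∀ j : ℕ, 0 < m (ball x ((1/2:ℝ) ^ j))) ∧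
    ∀ j, n ≤ j → av m (dk u) ((1/2:ℝ) ^ j) x ≤ ((L : ℝ≥0) : ℝ≥0∞)} with hK
  have hKm : ∀ L n, MeasurableSet (K L n) := by
    intro L n
    refine hΩ.inter (MeasurableSet.inter ?_ ?_)
    · have : {x : X | ∀ j : ℕ, 0 < m (ball x ((1/2:ℝ) ^ j))} =
        ⋂ j : ℕ, {x : X | 0 < m (ball x ((1/2:ℝ) ^ j))} := by ext x; simp
      change MeasurableSet {x : X | ∀ j : ℕ, 0 < m (ball x ((1/2:ℝ) ^ j))}
      rw [this]
      exact MeasurableSet.iInter fun j => measurableSet_lt measurable_const (measurable_measure_ball _)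
    · change MeasurableSet {x : X | ∀ j, n ≤ j → av m (dk u) ((1/2:ℝ) ^ j) x ≤ ((L : ℝ≥0) : ℝ≥0∞)}
      have : {x : X | ∀ j, n ≤ j → av m (dk u) ((1/2:ℝ) ^ j) x ≤ ((L : ℝ≥0) : ℝ≥0∞)} =
        ⋂ j : ℕ, ⋂ (_ : n ≤ j), {x : X | av m (dk u) ((1/2:ℝ) ^ j) x ≤ ((L : ℝ≥0) : ℝ≥0∞)} := by
          ext x; simp
      rw [this]
      exact MeasurableSet.iInter fun j => MeasurableSet.iInter fun _ =>
        measurableSet_le (measurable_av hD _) measurable_const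
  set p := TopologicalSpace.denseSeq X with hp
  have hlip : ∀ L n i, ∃ M, LipschitzOnWith M u (K L n ∩ ball (p i) ((1/2:ℝ) ^ (n + 2))) := by
    intro L n i
    refine ⟨NNReal.sqrt (32 * (L * (C + C ^ 2))), LipschitzOnWith.of_dist_le_mul ?_⟩
    rintro x ⟨hxK, hxp⟩ y ⟨hyK, hyp⟩
    rcases eq_or_ne x y with rfl | hne
    · simp
    have hρ : 0 < dist x y := dist_pos.2 hne
    have hρ1 : dist x y < (1/2:ℝ) ^ (n + 1) := by
      have := dist_triangle_right x y (p i)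
      rw [mem_ball] at hxp hyp
      have h2 : (1/2:ℝ) ^ (n + 1) = 2 * (1/2:ℝ) ^ (n + 2) := by rw [pow_succ (1/2:ℝ) (n+1)]; ring
      linarith
    obtain ⟨k, hk1, hk2⟩ := exists_nat_pow_near_of_lt_one hρ
      (hρ1.le.trans (pow_le_one₀ (by norm_num) (by norm_num))) (by norm_num : (0:ℝ) < 1/2) (by norm_num)
    have hkn : n + 1 ≤ k := by
      by_contra hcon
      have : (1/2:ℝ) ^ (n+1) ≤ (1/2:ℝ) ^ (k + 1) :=
        pow_le_pow_of_le_one (by norm_num) (by norm_num) (by omega)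
      linarith
    obtain ⟨j, rfl⟩ : ∃ j, k = j + 1 := ⟨k - 1, by omega⟩
    have e1 : (1/2:ℝ) ^ (j + 1) = (1/2:ℝ) ^ j / 2 := by rw [pow_succ]; ring
    have e2 : (1/2:ℝ) ^ (j + 1 + 1) = (1/2:ℝ) ^ j / 4 := by rw [pow_succ, pow_succ]; ring
    have hsp : (0:ℝ) < (1/2:ℝ) ^ j := by positivity
    have hs1 : (1/2:ℝ) ^ j ≤ 1 := pow_le_one₀ (by norm_num) (by norm_num)
    have h := two_point hfin hD hC (x := x) (y := y) (s := (1/2:ℝ) ^ j) (L := L) hsp (by linarith)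
      (by rw [← e1]; exact hk2) (by rw [← e1]; exact hxK.2.1 _) (hxK.2.2 j (by omega)) (hyK.2.2 j (by omega))
    rw [e2] at hk1
    have h6 : dist (u x) (u y) ^ 2 ≤ 32 * (L * (C + C ^ 2)) * dist x y ^ 2 := by
      have : ((1/2:ℝ) ^ j) ^ 2 ≤ (4 * dist x y) ^ 2 := by gcongr; linarith
      calc _ ≤ _ := h
        _ ≤ 2 * (((L : ℝ≥0) : ℝ) * (C + C ^ 2)) * (4 * dist x y) ^ 2 := by gcongr
        _ = _ := by simp; ring
    have h7 := Real.sqrt_le_sqrt h6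
    rw [Real.sqrt_sq dist_nonneg, Real.sqrt_mul (by positivity), Real.sqrt_sq dist_nonneg] at h7
    rw [Real.coe_sqrt]
    push_cast
    exact h7
  set dec : ℕ → ℕ × ℕ × ℕ := fun a => (a.unpair.1, a.unpair.2.unpair) with hdec
  refine ⟨fun a => K (dec a).1 (dec a).2.1 ∩ ball (p (dec a).2.2) ((1/2:ℝ) ^ ((dec a).2.1 + 2)),
    fun a => ⟨(hKm _ _).inter measurableSet_ball, inter_subset_left.trans inter_subset_left, hlip _ _ _⟩, ?_⟩
  filter_upwards [hb, ae_ball_pos m] with x hx hpos hxΩ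
  obtain ⟨B, hB, hev⟩ := hx hxΩ
  obtain ⟨L, hL⟩ := exists_nat_gt B.toReal
  have hBL : B ≤ ((L : ℝ≥0) : ℝ≥0∞) := by
    rw [← ENNReal.ofReal_toReal hB, ← ENNReal.ofReal_coe_nnreal]
    exact ENNReal.ofReal_le_ofReal (by simpa using hL.le)
  have hseq : Tendsto (fun j : ℕ => (1/2:ℝ) ^ j) atTop (𝓝[>] 0) :=
    tendsto_nhdsWithin_iff.2 ⟨tendsto_pow_atTop_nhds_zero_of_lt_one (by norm_num) (by norm_num),
      Eventually.of_forall fun n => by simp only [mem_Ioi]; positivity⟩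
  obtain ⟨n, hn⟩ := eventually_atTop.1 (hseq.eventually hev)
  obtain ⟨i, hi⟩ := (TopologicalSpace.denseRange_denseSeq X).exists_dist_lt x
    (show (0:ℝ) < (1/2:ℝ) ^ (n + 2) by positivity)
  refine ⟨Nat.pair L (Nat.pair n i), ?_⟩
  simp only [hdec, Nat.unpair_pair]
  exact ⟨⟨hxΩ, fun j => hpos _ (by positivity), fun j hj => (hn j hj).trans hBL⟩, hi⟩
end lusin


section bridge
variable [MetricSpace X] [SecondCountableTopology X] [MeasurableSpace X] [BorelSpace X] {m : Measure X}
  [MetricSpace Y]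

lemma borelMeas_sm {u : X → Y} (hu : BorelMeas u) (hsep : TopologicalSpace.IsSeparable (range u)) :
    StronglyMeasurable u := by
  borelize Y
  exact stronglyMeasurable_iff_measurable_separable.2 ⟨measurable_of_isOpen hu, hsep⟩

/-- extension by a constant -/
def extc (Ω : Set X) (o : Y) (u : X → Y) (x : X) : Y := if x ∈ Ω then u x else o

lemma extc_sm {Ω : Set X} (hΩ : MeasurableSet Ω) (o : Y) {u : X → Y} (hu : BorelMeas u)
    (hsep : TopologicalSpace.IsSeparable (u '' Ω)) : StronglyMeasurable (extc Ω o u) := by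
  apply borelMeas_sm
  · borelize Y
    have h1 : Measurable u := measurable_of_isOpen hu
    have : Measurable (extc Ω o u) := Measurable.ite hΩ h1 measurable_const
    exact fun s hs => this hs.measurableSet
  · refine (hsep.union (countable_singleton o).isSeparable).mono ?_
    rintro _ ⟨x, rfl⟩
    unfold extc
    split_ifs with h
    · exact Or.inl ⟨x, h, rfl⟩
    · exact Or.inr rfl

lemma dist_meas {u : X → Y} (hu : StronglyMeasurable u) :
    Measurable (fun p : X × X => dist (u p.1) (u p.2)) :=
  ((hu.comp_measurable measurable_fst).dist (hu.comp_measurable measurable_snd)).measurable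

lemma dk_meas {u : X → Y} (hu : StronglyMeasurable u) : Measurable (Function.uncurry (dk u)) :=
  ENNReal.measurable_ofReal.comp ((dist_meas hu).pow_const 2)

/-- good/bad predicate -/
def bad (v w : X → Y) (α : ℝ) (x : X) : Set X := {y | α ≤ dist (v x) (v y) ∨ α ≤ dist (w x) (w y)}

/-- modified kernel -/
def dmod (u v w : X → Y) (α : ℝ) (x y : X) : ℝ≥0∞ := (bad v w α x)ᶜ.indicator (dk u x) y

/-- bad part of the kernel -/
def dbad (u v w : X → Y) (α : ℝ) (x y : X) : ℝ≥0∞ := (bad v w α x).indicator (dk u x) y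

lemma bad_prod_meas {v w : X → Y} (hv : StronglyMeasurable v) (hw : StronglyMeasurable w) (α : ℝ) :
    MeasurableSet {p : X × X | p.2 ∈ bad v w α p.1} :=
  (measurableSet_le measurable_const (dist_meas hv)).union
    (measurableSet_le measurable_const (dist_meas hw))

lemma bad_meas {v w : X → Y} (hv : StronglyMeasurable v) (hw : StronglyMeasurable w) (α : ℝ) (x : X) :
    MeasurableSet (bad v w α x) :=
  (bad_prod_meas hv hw α).preimage (measurable_prodMk_left (x := x))

lemma dmod_meas {u v w : X → Y} (hu : StronglyMeasurable u) (hv : StronglyMeasurable v)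
    (hw : StronglyMeasurable w) (α : ℝ) : Measurable (Function.uncurry (dmod u v w α)) := by
  have : Function.uncurry (dmod u v w α) =
      {p : X × X | p.2 ∈ bad v w α p.1}ᶜ.indicator (Function.uncurry (dk u)) := by
    funext ⟨x, y⟩
    simp [dmod, indicator, Function.uncurry]
  rw [this]
  exact (dk_meas hu).indicator (bad_prod_meas hv hw α).compl

lemma dbad_meas {u v w : X → Y} (hu : StronglyMeasurable u) (hv : StronglyMeasurable v)
    (hw : StronglyMeasurable w) (α : ℝ) : Measurable (Function.uncurry (dbad u v w α)) := by
  have : Function.uncurry (dbad u v w α) =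
      {p : X × X | p.2 ∈ bad v w α p.1}.indicator (Function.uncurry (dk u)) := by
    funext ⟨x, y⟩
    simp [dbad, indicator, Function.uncurry]
  rw [this]
  exact (dk_meas hu).indicator (bad_prod_meas hv hw α)

lemma dmod_add_dbad (u v w : X → Y) (α : ℝ) : (fun x y => dmod u v w α x y + dbad u v w α x y) = dk u := by
  funext x y
  by_cases h : y ∈ bad v w α x <;> simp [dmod, dbad, h]

lemma approx_cont (hfin : FiniteOnBounded m) (hdoub : LocUnifDoubling m) {v : X → Y}
    (hv : StronglyMeasurable v) {α : ℝ} (hα : 0 < α) :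
    ∀ᵐ x ∂m, Tendsto (fun r => m (ball x r ∩ {y | α ≤ dist (v x) (v y)}) / m (ball x r))
      (𝓝[>] 0) (𝓝 0) := by
  have : IsLocallyFiniteMeasure m := locFin_of_bdd hfin
  obtain ⟨c, hc, hcl⟩ := hv.isSeparable_range
  have hd : ∀ q ∈ c, ∀ᵐ x ∂m, x ∈ v ⁻¹' ball q (α / 2) →
      Tendsto (fun r => m (ball x r \ v ⁻¹' ball q (α / 2)) / m (ball x r)) (𝓝[>] 0) (𝓝 0) := by
    intro q _
    borelize Y
    exact density_ball hdoub (hv.measurable measurableSet_ball)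
  filter_upwards [(ae_ball_iff hc).2 hd] with x hx
  obtain ⟨q, hq, hxq⟩ := Metric.mem_closure_iff.1 (hcl (mem_range_self x)) (α / 2) (by linarith)
  refine tendsto_of_tendsto_of_tendsto_of_le_of_le tendsto_const_nhds (hx q hq hxq)
    (fun _ => bot_le) (fun r => ?_)
  dsimp only
  gcongr
  rintro y ⟨hy, hyα⟩
  refine ⟨hy, fun hyq => ?_⟩
  have h1 : dist (v y) q < α / 2 := hyq
  have h2 := dist_triangle_right (v x) (v y) q
  have h3 : α ≤ dist (v x) (v y) := hyα
  linarith

lemma approx_cont_bad (hfin : FiniteOnBounded m) (hdoub : LocUnifDoubling m) {v w : X → Y}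
    (hv : StronglyMeasurable v) (hw : StronglyMeasurable w) {α : ℝ} (hα : 0 < α) :
    ∀ᵐ x ∂m, Tendsto (fun r => m (ball x r ∩ bad v w α x) / m (ball x r)) (𝓝[>] 0) (𝓝 0) := by
  filter_upwards [approx_cont hfin hdoub hv hα, approx_cont hfin hdoub hw hα] with x h1 h2
  have h3 := h1.add h2
  rw [add_zero] at h3
  refine tendsto_of_tendsto_of_tendsto_of_le_of_le tendsto_const_nhds h3
    (fun _ => bot_le) (fun r => ?_)
  dsimp only
  rw [← ENNReal.add_div]
  gcongr
  refine (measure_mono ?_).trans (measure_union_le _ _)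
  rintro y ⟨hy, h | h⟩
  · exact Or.inl ⟨hy, h⟩
  · exact Or.inr ⟨hy, h⟩

lemma av_ne_top (hfin : FiniteOnBounded m) {u : X → Y} (hu : StronglyMeasurable u) {o : Y}
    (hL : ∫⁻ y, ENNReal.ofReal (dist (u y) o ^ 2) ∂m ≠ ∞) {r : ℝ} (hr : 0 < r) (x : X) :
    av m (dk u) r x ≠ ∞ := by
  unfold av
  by_cases h0 : m (ball x r) = 0
  · rw [Measure.restrict_eq_zero.2 h0]
    simp
  have hr2 : ENNReal.ofReal (r ^ 2) ≠ 0 := by simp; positivity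
  refine ENNReal.div_ne_top ?_ (mul_ne_zero h0 hr2)
  have hfb : m (ball x r) ≠ ∞ := (hfin _ isBounded_ball).ne
  have hb : ∫⁻ y in ball x r, dk u x y ∂m ≤
      ∫⁻ y in ball x r, 2 * (ENNReal.ofReal (dist (u x) o ^ 2) + ENNReal.ofReal (dist (u y) o ^ 2)) ∂m := by
    refine lintegral_mono fun y => ?_
    unfold dk
    rw [← ENNReal.ofReal_add (by positivity) (by positivity), ← ENNReal.ofReal_ofNat 2,
      ← ENNReal.ofReal_mul (by norm_num)]
    apply ENNReal.ofReal_le_ofReal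
    have h1 := dist_triangle_right (u x) (u y) o
    have h2 : 0 ≤ dist (u x) (u y) := dist_nonneg
    nlinarith [sq_nonneg (dist (u x) o - dist (u y) o)]
  refine ne_top_of_le_ne_top ?_ hb
  rw [lintegral_const_mul' _ _ (by simp), lintegral_add_left measurable_const, setLIntegral_const]
  refine ENNReal.mul_ne_top (by simp) (ENNReal.add_ne_top.2 ⟨ENNReal.mul_ne_top (by simp) hfb, ?_⟩)
  exact ne_top_of_le_ne_top hL (setLIntegral_le_lintegral _ _)

lemma extc_eq {Ω : Set X} (o : Y) (u : X → Y) {x : X} (hx : x ∈ Ω) : extc Ω o u x = u x := if_pos hx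

lemma ks2rMod_eq {Ω : Set X} (o : Y) {u v w : X → Y} {α : ℝ}
    (hu : StronglyMeasurable (extc Ω o u)) (hv : StronglyMeasurable (extc Ω o v))
    (hw : StronglyMeasurable (extc Ω o w)) {r : ℝ} (hr : 0 < r) {x : X} (hx : ball x r ⊆ Ω) :
    ks2rMod m Ω u v w α r x =
      √(av m (dmod (extc Ω o u) (extc Ω o v) (extc Ω o w) α) r x).toReal := by
  have hxΩ : x ∈ Ω := hx (mem_ball_self hr)
  unfold ks2rMod
  rw [if_pos hx]
  congr 1
  have hg : Measurable (fun y => dist (extc Ω o u x) (extc Ω o u y) ^ 2) :=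
    ((dist_meas hu).comp (measurable_prodMk_left (x := x))).pow_const 2
  have h := real_avg (m := m) (T := ball x r) hg (fun y => by positivity) (bad_meas hv hw α x) hr
  have hset : ball x r \ badSet Ω v w α x = ball x r \ bad (extc Ω o v) (extc Ω o w) α x := by
    ext y
    simp only [Set.mem_sdiff, badSet, bad, mem_ofPred_eq]
    refine and_congr_right fun hy => not_congr ?_
    rw [extc_eq o v hxΩ, extc_eq o w hxΩ, extc_eq o v (hx hy), extc_eq o w (hx hy)]
    simp [hx hy]
  rw [hset]
  refine Eq.trans ?_ h
  congr 1
  refine setIntegral_congr_fun (measurableSet_ball.diff (bad_meas hv hw α x)) fun y hy => ?_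
  rw [extc_eq o u hxΩ, extc_eq o u (hx hy.1)]

lemma ks2r_eq {Ω : Set X} (o : Y) {u : X → Y}
    (hu : StronglyMeasurable (extc Ω o u)) {r : ℝ} (hr : 0 < r) {x : X} (hx : ball x r ⊆ Ω) :
    ks2r m Ω u r x = √(av m (dk (extc Ω o u)) r x).toReal := by
  have hxΩ : x ∈ Ω := hx (mem_ball_self hr)
  unfold ks2r
  rw [if_pos hx]
  congr 1
  have hg : Measurable (fun y => dist (extc Ω o u x) (extc Ω o u y) ^ 2) :=
    ((dist_meas hu).comp (measurable_prodMk_left (x := x))).pow_const 2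
  have h := real_avg (m := m) (T := ball x r) hg (fun y => by positivity) MeasurableSet.empty hr
  rw [setAverage_eq, smul_eq_mul, Measure.real]
  simp only [sdiff_empty, compl_empty, indicator_univ] at h
  refine Eq.trans ?_ h
  congr 1
  refine setIntegral_congr_fun measurableSet_ball fun y hy => ?_
  rw [extc_eq o u hxΩ, extc_eq o u (hx hy)]
end bridge


section final
variable [MetricSpace X] [CompleteSpace X] [TopologicalSpace.SeparableSpace X]
  [MeasurableSpace X] [BorelSpace X] {m : Measure X} [MetricSpace Y]

lemma av_ind {D : X → X → ℝ≥0∞} {E : Set X} (hE : MeasurableSet E) (r : ℝ) (x : X) :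
    av m (fun x y => E.indicator (D x) y) r x =
      (∫⁻ y in ball x r ∩ E, D x y ∂m) / (m (ball x r) * ENNReal.ofReal (r ^ 2)) := by
  unfold av
  rw [lintegral_indicator hE, Measure.restrict_restrict hE, inter_comm]

lemma ind_meas {D : X → X → ℝ≥0∞} (hD : Measurable (Function.uncurry D)) {E : Set X} (hE : MeasurableSet E) :
    Measurable (Function.uncurry (fun x y => E.indicator (D x) y)) := by
  have : Function.uncurry (fun x y => E.indicator (D x) y) =
      (univ ×ˢ E).indicator (Function.uncurry D) := by
    funext ⟨x, y⟩
    simp [indicator, Function.uncurry]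
  rw [this]
  exact hD.indicator (MeasurableSet.univ.prod hE)

lemma av_mono {D D' : X → X → ℝ≥0∞} {r : ℝ} {x : X} (h : ∀ y ∈ ball x r, D x y ≤ D' x y) :
    av m D r x ≤ av m D' r x := by
  unfold av
  gcongr ?_ / _
  exact setLIntegral_mono' measurableSet_ball h

lemma far_conv (hfin : FiniteOnBounded m) (hdoub : LocUnifDoubling m) {d : ℕ}
    (hrect : StronglyRectifiable m d) {u : X → Y} (hu : StronglyMeasurable u) {o : Y}
    (hL : ∫⁻ y, ENNReal.ofReal (dist (u y) o ^ 2) ∂m ≠ ∞) {E : Set X} (hE : MeasurableSet E)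
    {L : ℝ≥0} (hlip : LipschitzOnWith L u E)
    (hA : ∀ᵐ x ∂m, x ∈ E → ∃ a, Tendsto (fun r => av m (dk u) r x) (𝓝[>] 0) (𝓝 a)) :
    ∀ᵐ x ∂m, x ∈ E → ∃ l, Tendsto (fun r => av m (fun x y => Eᶜ.indicator (dk u x) y) r x)
      (𝓝[>] 0) (𝓝 l) := by
  have : SecondCountableTopology X := UniformSpace.secondCountable_of_separable X
  have hsep : TopologicalSpace.SeparableSpace (range u) := hu.isSeparable_range.separableSpace
  set f : X → Linf := fun x => kuratowskiEmbedding (range u) ⟨u x, mem_range_self x⟩ with hf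
  have hfd : ∀ x y, dist (f x) (f y) = dist (u x) (u y) := fun x y =>
    (kuratowskiEmbedding.isometry (range u)).dist_eq _ _
  have hfl : LipschitzOnWith L f E := LipschitzOnWith.of_dist_le_mul fun x hx y hy => by
    rw [hfd]; exact hlip.dist_le_mul x hx y hy
  filter_upwards [hA, P_tendsto hfin hdoub hrect hE hfl] with x h1 h2 hxE
  obtain ⟨a, ha⟩ := h1 hxE
  obtain ⟨l, hl, hlt⟩ := h2 hxE
  refine ⟨a - l, ?_⟩
  refine (ENNReal.Tendsto.sub ha hlt (Or.inr hl)).congr' ?_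
  filter_upwards [self_mem_nhdsWithin] with r hr
  have h3 : av m (dk u) r x = av m (fun x y => E.indicator (dk u x) y) r x +
      av m (fun x y => Eᶜ.indicator (dk u x) y) r x := by
    rw [← av_add (ind_meas (dk_meas hu) hE)]
    congr 1
    funext x y
    by_cases hy : y ∈ E <;> simp [hy]
  have h4 : av m (fun x y => E.indicator (dk u x) y) r x ≠ ∞ :=
    ne_top_of_le_ne_top (av_ne_top hfin hu hL hr x) (h3 ▸ le_self_add)
  have h5 : (∫⁻ y in ball x r ∩ E, ENNReal.ofReal (‖f x - f y‖ ^ 2) ∂m) /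
        (m (ball x r) * ENNReal.ofReal (r ^ 2)) = av m (fun x y => E.indicator (dk u x) y) r x := by
    rw [av_ind hE]
    congr 1
    refine lintegral_congr fun y => ?_
    rw [← dist_eq_norm, hfd]
    rfl
  rw [h5, h3, ENNReal.add_sub_cancel_left h4]

lemma bad_limit {u v w : X → Y} {α : ℝ} (hu : StronglyMeasurable u)
    (hv : StronglyMeasurable v) (hw : StronglyMeasurable w) {E : Set X} (hE : MeasurableSet E)
    {L : ℝ≥0} (hlip : LipschitzOnWith L u E) {x : X} (hx : x ∈ E)
    (hfb : ∀ r, m (ball x r) ≠ ∞) (hpos : ∀ r, 0 < r → 0 < m (ball x r))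
    (h1 : Tendsto (fun r => av m (fun x y => Eᶜ.indicator (dk u x) y) r x) (𝓝[>] 0) (𝓝 0))
    (h2 : Tendsto (fun r => m (ball x r ∩ bad v w α x) / m (ball x r)) (𝓝[>] 0) (𝓝 0)) :
    Tendsto (fun r => av m (dbad u v w α) r x) (𝓝[>] 0) (𝓝 0) := by
  have : SecondCountableTopology X := UniformSpace.secondCountable_of_separable X
  have h3 := h1.add (ENNReal.Tendsto.const_mul (a := ENNReal.ofReal (L ^ 2)) h2 (Or.inr ENNReal.ofReal_ne_top))
  rw [mul_zero, add_zero] at h3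
  refine tendsto_of_tendsto_of_tendsto_of_le_of_le' tendsto_const_nhds h3
    (Eventually.of_forall fun _ => bot_le) ?_
  filter_upwards [self_mem_nhdsWithin] with r hr
  have hr0 : (0:ℝ) < r := hr
  have hr2 : ENNReal.ofReal (r ^ 2) ≠ 0 := by simp; positivity
  have hbm := bad_meas hv hw α x
  have e1 : ENNReal.ofReal (L ^ 2) * (m (ball x r ∩ bad v w α x) / m (ball x r)) =
      av m (fun _ y => (bad v w α x).indicator (fun _ => ENNReal.ofReal (L ^ 2 * r ^ 2)) y) r x := by
    unfold av
    rw [lintegral_indicator hbm, Measure.restrict_restrict hbm, setLIntegral_const, inter_comm,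
      ENNReal.ofReal_mul (by positivity), mul_right_comm,
      ENNReal.mul_div_mul_right _ _ hr2 ENNReal.ofReal_ne_top, mul_div_assoc]
  rw [e1, ← av_add (ind_meas (dk_meas hu) hE.compl)]
  refine av_mono fun y hy => ?_
  unfold dbad
  by_cases hb : y ∈ bad v w α x
  · by_cases hyE : y ∈ E
    · simp only [hb, indicator_of_mem]
      refine le_add_left ?_
      unfold dk
      apply ENNReal.ofReal_le_ofReal
      rw [← mul_pow]
      gcongr
      refine (hlip.dist_le_mul x hx y hyE).trans ?_
      gcongr
      rw [dist_comm]
      exact (mem_ball.1 hy).le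
    · simp [hb, hyE]
  · simp [hb]

theorem main_thm
    (hfin : FiniteOnBounded m)
    (d : ℕ) (hdoub : LocUnifDoubling m) (hrect : StronglyRectifiable m d)
    (Ω : Set X) (hΩopen : IsOpen Ω) (o : Y)
    (u v w : X → Y) (hu : MemKS m Ω o u) (hv : MemKS m Ω o v) (hw : MemKS m Ω o w)
    (α : ℝ) (hα : 0 < α)
    (e : X → ℝ) (he : IsEnergyDensity m Ω u e) :
    (∀ᵐ x ∂m.restrict Ω,
      Filter.Tendsto (fun r => ks2rMod m Ω u v w α r x) (𝓝[>] (0:ℝ)) (𝓝 (e x))) ∧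
    Filter.Tendsto
      (fun r => ∫⁻ x in Ω, ENNReal.ofReal ((ks2rMod m Ω u v w α r x - e x) ^ 2) ∂m)
      (𝓝[>] (0:ℝ)) (𝓝 0) := by
  have : SecondCountableTopology X := UniformSpace.secondCountable_of_separable X
  have : IsLocallyFiniteMeasure m := locFin_of_bdd hfin
  have hΩm := hΩopen.measurableSet
  obtain ⟨he1, he2⟩ := he
  have hU := extc_sm hΩm o hu.1.1 hu.1.2.1
  have hV := extc_sm hΩm o hv.1.1 hv.1.2.1
  have hW := extc_sm hΩm o hw.1.1 hw.1.2.1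
  have hL : ∫⁻ y, ENNReal.ofReal (dist (extc Ω o u y) o ^ 2) ∂m ≠ ∞ := by
    have h1 : (fun y => ENNReal.ofReal (dist (extc Ω o u y) o ^ 2)) =
        Ω.indicator (fun y => ENNReal.ofReal (dist (u y) o ^ 2)) := by
      funext y
      by_cases hy : y ∈ Ω <;> simp [extc, hy]
    rw [h1, lintegral_indicator hΩm]
    exact hu.1.2.2.ne
  have hksE : ∀ {r : ℝ}, 0 < r → ∀ {x}, ball x r ⊆ Ω →
      ks2r m Ω u r x = √(av m (dk (extc Ω o u)) r x).toReal := fun hr _ hx => ks2r_eq o hU hr hx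
  have hmodE : ∀ {r : ℝ}, 0 < r → ∀ {x}, ball x r ⊆ Ω → ks2rMod m Ω u v w α r x =
      √(av m (dmod (extc Ω o u) (extc Ω o v) (extc Ω o w) α) r x).toReal :=
    fun hr _ hx => ks2rMod_eq o hU hV hW hr hx
  generalize extc Ω o u = U at *
  generalize extc Ω o v = V at *
  generalize extc Ω o w = W at *
  have hAfin : ∀ {r : ℝ}, 0 < r → ∀ x, av m (dk U) r x ≠ ∞ := fun hr x => av_ne_top hfin hU hL hr x
  have hAsum : ∀ r x, av m (dk U) r x = av m (dmod U V W α) r x + av m (dbad U V W α) r x := by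
    intro r x
    rw [← av_add (dmod_meas hU hV hW α), dmod_add_dbad]
  have hks0 : ∀ r x, 0 ≤ ks2r m Ω u r x := by
    intro r x; unfold ks2r; split_ifs
    · exact Real.sqrt_nonneg _
    · exact le_rfl
  have hmod0 : ∀ r x, 0 ≤ ks2rMod m Ω u v w α r x := by
    intro r x; unfold ks2rMod; split_ifs
    · exact Real.sqrt_nonneg _
    · exact le_rfl
  have hmodle : ∀ {r : ℝ}, 0 < r → ∀ x, ks2rMod m Ω u v w α r x ≤ ks2r m Ω u r x := by
    intro r hr x
    by_cases hx : ball x r ⊆ Ω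
    · rw [hksE hr hx, hmodE hr hx]
      refine Real.sqrt_le_sqrt (ENNReal.toReal_mono (hAfin hr x) ?_)
      rw [hAsum]
      exact le_self_add
    · simp [ks2r, ks2rMod, hx]
  have hksM : ∀ {r : ℝ}, 0 < r → Measurable (ks2r m Ω u r) := by
    intro r hr
    have : ks2r m Ω u r = {x : X | ball x r ⊆ Ω}.indicator (fun x => √(av m (dk U) r x).toReal) := by
      funext x
      by_cases hx : ball x r ⊆ Ω
      · rw [hksE hr hx, indicator_of_mem]
        exact hx
      · rw [indicator_of_notMem]
        · simp [ks2r, hx]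
        · exact hx
    rw [this]
    exact ((measurable_av (dk_meas hU) r).ennreal_toReal.sqrt).indicator
      (isClosed_ball_subset Ω r).measurableSet
  have hmodM : ∀ {r : ℝ}, 0 < r → Measurable (ks2rMod m Ω u v w α r) := by
    intro r hr
    have : ks2rMod m Ω u v w α r =
        {x : X | ball x r ⊆ Ω}.indicator (fun x => √(av m (dmod U V W α) r x).toReal) := by
      funext x
      by_cases hx : ball x r ⊆ Ω
      · rw [hmodE hr hx, indicator_of_mem]
        exact hx
      · rw [indicator_of_notMem]
        · simp [ks2rMod, hx]
        · exact hx
    rw [this]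
    exact ((measurable_av (dmod_meas hU hV hW α) r).ennreal_toReal.sqrt).indicator
      (isClosed_ball_subset Ω r).measurableSet
  have hev : ∀ x ∈ Ω, ∀ᶠ r : ℝ in 𝓝[>] 0, 0 < r ∧ ball x r ⊆ Ω := by
    intro x hx
    obtain ⟨δ, hδ, hb⟩ := Metric.isOpen_iff.1 hΩopen x hx
    filter_upwards [Ioo_mem_nhdsGT hδ] with r hr
    exact ⟨hr.1, (ball_subset_ball hr.2.le).trans hb⟩
  have hksA : ∀ {r : ℝ}, 0 < r → ∀ {x}, ball x r ⊆ Ω →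
      av m (dk U) r x = ENNReal.ofReal (ks2r m Ω u r x ^ 2) := by
    intro r hr x hx
    rw [hksE hr hx, Real.sq_sqrt ENNReal.toReal_nonneg, ENNReal.ofReal_toReal (hAfin hr x)]
  have he1' : ∀ᵐ x ∂m, x ∈ Ω → Tendsto (fun r => ks2r m Ω u r x) (𝓝[>] (0:ℝ)) (𝓝 (e x)) :=
    (ae_restrict_iff' hΩm).1 he1
  have hA : ∀ᵐ x ∂m, x ∈ Ω → 0 ≤ e x ∧
      Tendsto (fun r => av m (dk U) r x) (𝓝[>] 0) (𝓝 (ENNReal.ofReal (e x ^ 2))) := by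
    filter_upwards [he1'] with x hx hxΩ
    refine ⟨ge_of_tendsto' (hx hxΩ) fun r => hks0 r x, ?_⟩
    refine (ENNReal.tendsto_ofReal ((hx hxΩ).pow 2)).congr' ?_
    filter_upwards [hev x hxΩ] with r hr
    exact (hksA hr.1 hr.2).symm
  -- measurability and integrability of e
  have hseq : Tendsto (fun n : ℕ => 1 / ((n:ℝ) + 1)) atTop (𝓝[>] 0) :=
    tendsto_nhdsWithin_iff.2 ⟨tendsto_one_div_add_atTop_nhds_zero_nat,
      Eventually.of_forall fun n => by simp only [mem_Ioi]; positivity⟩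
  have hem : AEMeasurable e (m.restrict Ω) :=
    aemeasurable_of_tendsto_metrizable_ae' (f := fun n : ℕ => ks2r m Ω u (1 / ((n:ℝ) + 1)))
      (fun n => (hksM (by positivity)).aemeasurable) (he1.mono fun x hx => hx.comp hseq)
  have hsq : ∀ a b : ℝ, ENNReal.ofReal (a ^ 2) ≤
      2 * ENNReal.ofReal (b ^ 2) + 2 * ENNReal.ofReal ((a - b) ^ 2) := by
    intro a b
    rw [← ENNReal.ofReal_ofNat 2, ← ENNReal.ofReal_mul (by norm_num), ← ENNReal.ofReal_mul (by norm_num),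
      ← ENNReal.ofReal_add (by positivity) (by positivity)]
    apply ENNReal.ofReal_le_ofReal
    nlinarith [sq_nonneg (a - 2 * b)]
  have heL : ∫⁻ x in Ω, ENNReal.ofReal (e x ^ 2) ∂m ≠ ∞ := by
    have hf := frequently_lt_of_liminf_lt (h := hu.2)
    have hev2 := he2.eventually (gt_mem_nhds (show (0:ℝ≥0∞) < 1 by norm_num))
    obtain ⟨r, hr1, hr2, hr3⟩ := (hf.and_eventually (hev2.and self_mem_nhdsWithin)).exists
    have hr0 : 0 < r := hr3
    have : ∫⁻ x in Ω, ENNReal.ofReal (e x ^ 2) ∂m ≤ 2 * ∫⁻ x in Ω, ENNReal.ofReal (ks2r m Ω u r x ^ 2) ∂m +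
        2 * ∫⁻ x in Ω, ENNReal.ofReal ((ks2r m Ω u r x - e x) ^ 2) ∂m := by
      rw [← lintegral_const_mul' _ _ (by simp), ← lintegral_const_mul' _ _ (by simp), ← lintegral_add_left
        (((hksM hr0).pow_const 2).ennreal_ofReal.const_mul 2)]
      refine lintegral_mono fun x => ?_
      refine (hsq (e x) (ks2r m Ω u r x)).trans_eq ?_
      rw [← neg_sub, neg_sq]
    refine ne_top_of_le_ne_top ?_ this
    exact ENNReal.add_ne_top.2 ⟨ENNReal.mul_ne_top (by simp) hr1.ne,
      ENNReal.mul_ne_top (by simp) (hr2.trans ENNReal.one_lt_top).ne⟩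
  -- Lipschitz pieces
  obtain ⟨E, hE, hcov⟩ := lusin_lip hfin hdoub hΩm (dk_meas hU) (by
    filter_upwards [hA] with x hx hxΩ
    refine ⟨ENNReal.ofReal (e x ^ 2) + 1, by simp, ?_⟩
    have := (hx hxΩ).2.eventually (gt_mem_nhds (ENNReal.lt_add_right ENNReal.ofReal_ne_top one_ne_zero))
    exact this.mono fun r hr => hr.le)
  have hfar : ∀ i, ∀ᵐ x ∂m, x ∈ E i →
      Tendsto (fun r => av m (fun x y => (E i)ᶜ.indicator (dk U x) y) r x) (𝓝[>] 0) (𝓝 0) := by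
    intro i
    obtain ⟨hEm, hEΩ, L, hlip⟩ := hE i
    refine far_small hfin hdoub hΩopen hEm hEΩ (dk_meas hU)
      (fun x y => by unfold dk; rw [dist_comm]) heL
      (η := fun r => 2 * ∫⁻ x in Ω, ENNReal.ofReal ((ks2r m Ω u r x - e x) ^ 2) ∂m) ?_ ?_ ?_
    · have := ENNReal.Tendsto.const_mul (a := 2) he2 (Or.inr (by simp))
      rwa [mul_zero] at this
    · filter_upwards [self_mem_nhdsWithin] with r hr S hS hSΩ hSb
      have hr0 : 0 < r := hr
      calc ∫⁻ x in S, av m (dk U) r x ∂m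
          ≤ ∫⁻ x in S, (2 * ENNReal.ofReal (e x ^ 2) + 2 * ENNReal.ofReal ((ks2r m Ω u r x - e x) ^ 2)) ∂m := by
            refine setLIntegral_mono' hS fun x hx => ?_
            rw [hksA hr0 (hSb x hx)]
            exact hsq _ _
        _ = 2 * ∫⁻ x in S, ENNReal.ofReal (e x ^ 2) ∂m +
            2 * ∫⁻ x in S, ENNReal.ofReal ((ks2r m Ω u r x - e x) ^ 2) ∂m := by
            rw [lintegral_add_left', lintegral_const_mul' _ _ (by simp), lintegral_const_mul' _ _ (by simp)]
            exact (((hem.mono_measure (Measure.restrict_mono hSΩ le_rfl)).pow_const 2).ennreal_ofReal).const_mul 2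
        _ ≤ _ := by
            gcongr
    · refine far_conv hfin hdoub hrect hU hL hEm hlip ?_
      filter_upwards [hA] with x hx hxE
      exact ⟨_, (hx (hEΩ hxE)).2⟩
  have hae : ∀ᵐ x ∂m, x ∈ Ω →
      Tendsto (fun r => ks2rMod m Ω u v w α r x) (𝓝[>] (0:ℝ)) (𝓝 (e x)) := by
    filter_upwards [hA, hcov, ae_all_iff.2 hfar, approx_cont_bad hfin hdoub hV hW hα, ae_ball_pos m]
      with x h1 h2 h3 h4 hpos hxΩ
    obtain ⟨h1a, h1b⟩ := h1 hxΩ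
    obtain ⟨i, hi⟩ := h2 hxΩ
    obtain ⟨hEm, hEΩ, L, hlip⟩ := hE i
    have hb := bad_limit hU hV hW hEm hlip hi (fun r => (hfin _ isBounded_ball).ne) hpos (h3 i hi) h4
    have hs := ENNReal.Tendsto.sub h1b hb (Or.inr (by simp))
    rw [tsub_zero] at hs
    have hs2 := ((ENNReal.tendsto_toReal ENNReal.ofReal_ne_top).comp hs).sqrt
    rw [ENNReal.toReal_ofReal (by positivity), Real.sqrt_sq h1a] at hs2
    refine hs2.congr' ?_
    filter_upwards [hev x hxΩ] with r hr
    rw [hmodE hr.1 hr.2]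
    simp only [Function.comp]
    rw [hAsum, ENNReal.add_sub_cancel_right]
    refine ne_top_of_le_ne_top (hAfin hr.1 x) ?_
    rw [hAsum]
    exact le_add_self
  refine ⟨(ae_restrict_iff' hΩm).2 hae, ?_⟩
  have he0 : ∀ᵐ x ∂m.restrict Ω, 0 ≤ e x := (ae_restrict_iff' hΩm).2 (hA.mono fun x hx hxΩ => (hx hxΩ).1)
  have hdom : Tendsto (fun r => ∫⁻ x in Ω, ENNReal.ofReal (max (e x - ks2rMod m Ω u v w α r x) 0 ^ 2) ∂m)
      (𝓝[>] (0:ℝ)) (𝓝 (∫⁻ x in Ω, 0 ∂m)) := by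
    refine tendsto_lintegral_filter_of_dominated_convergence' (fun x => ENNReal.ofReal (e x ^ 2))
      ?_ ?_ heL ?_
    · filter_upwards [self_mem_nhdsWithin] with r hr
      exact (((hem.sub (hmodM hr).aemeasurable).max aemeasurable_const).pow_const 2).ennreal_ofReal
    · refine Eventually.of_forall fun r => ?_
      filter_upwards [he0] with x hx
      apply ENNReal.ofReal_le_ofReal
      have : max (e x - ks2rMod m Ω u v w α r x) 0 ≤ e x := max_le (by linarith [hmod0 r x]) hx
      gcongr
    · filter_upwards [(ae_restrict_iff' hΩm).2 hae] with x hx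
      have h1 := ENNReal.tendsto_ofReal ((((tendsto_const_nhds (x := e x)).sub hx).max
        (tendsto_const_nhds (x := (0:ℝ)))).pow 2)
      simpa using h1
  rw [lintegral_zero] at hdom
  have hsum := he2.add hdom
  rw [add_zero] at hsum
  refine tendsto_of_tendsto_of_tendsto_of_le_of_le' tendsto_const_nhds hsum
    (Eventually.of_forall fun _ => bot_le) ?_
  filter_upwards [self_mem_nhdsWithin] with r hr
  have hr0 : 0 < r := hr
  have hmm : AEMeasurable (fun x => ENNReal.ofReal ((ks2r m Ω u r x - e x) ^ 2)) (m.restrict Ω) :=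
    (((hksM hr0).aemeasurable.sub hem).pow_const 2).ennreal_ofReal
  rw [← lintegral_add_left' hmm]
  refine lintegral_mono fun x => ?_
  rw [← ENNReal.ofReal_add (by positivity) (by positivity)]
  apply ENNReal.ofReal_le_ofReal
  have h1 := hmodle hr0 x
  rcases le_total (e x) (ks2rMod m Ω u v w α r x) with h | h
  · rw [max_eq_right (by linarith)]
    nlinarith
  · rw [max_eq_left (by linarith)]
    nlinarith [sq_nonneg (ks2r m Ω u r x - e x)]
end final

end secV

/-- Technical lemma: the modified approximate energies converge to the
energy density `e_2[u]`, `m`-a.e. on `Ω` and in `L²(Ω)`, as `r ↓ 0`. -/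
theorem ks2rMod_tendsto_energyDensity
    {X Y : Type*} [MetricSpace X] [CompleteSpace X] [TopologicalSpace.SeparableSpace X]
    [MeasurableSpace X] [BorelSpace X] [MetricSpace Y] [CompleteSpace Y]
    (m : Measure X) (hfin : FiniteOnBounded m)
    (d : ℕ) (hdoub : LocUnifDoubling m) (hrect : StronglyRectifiable m d)
    (hPI : PoincareIneq m)
    (Ω : Set X) (hΩopen : IsOpen Ω) (o : Y)
    (u v w : X → Y) (hu : MemKS m Ω o u) (hv : MemKS m Ω o v) (hw : MemKS m Ω o w)
    (α : ℝ) (hα : 0 < α)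
    (e2u : X → ℝ) (he2u : IsEnergyDensity m Ω u e2u) :
    (∀ᵐ x ∂m.restrict Ω,
      Filter.Tendsto (fun r => ks2rMod m Ω u v w α r x) (𝓝[>] (0:ℝ)) (𝓝 (e2u x))) ∧
    Filter.Tendsto
      (fun r => ∫⁻ x in Ω, ENNReal.ofReal ((ks2rMod m Ω u v w α r x - e2u x) ^ 2) ∂m)
      (𝓝[>] (0:ℝ)) (𝓝 0) := by
  exact main_thm hfin d hdoub hrect Ω hΩopen o u v w hu hv hw α hα e2u he2u

end KSH
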